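/- Let n ≥ 1 and let F, G ∈ C_c^∞(ℝ^{2n}). Then max{F,G} = liminf of max{F',G'} as F',G' → F,G in the uniform norm. Precisely, the nontrivial inequality is lower semicontinuity: for every ε > 0 there exists δ > 0 such that every pair F', G' ∈ C_c^∞(ℝ^{2n}) with ‖F' − F‖ < δ and ‖G' − G‖ < δ satisfies max{F',G'} > max{F,G} − ε. (The opposite inequality is witnessed by F' = F, G' = G.) -/

import Mathlib

/-- The phase space `ℝ^{2n} = ℝ^n × ℝ^n` with coordinates `(p, q)`. -/
abbrev Phase (n : ℕ) := (Fin n → ℝ) × (Fin n → ℝ)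

/-- Partial derivative `∂F/∂p_i`. -/
noncomputable def pderivP {n : ℕ} (F : Phase n → ℝ) (i : Fin n) (x : Phase n) : ℝ :=
  fderiv ℝ F x (Pi.single i 1, 0)

/-- Partial derivative `∂F/∂q_i`. -/
noncomputable def pderivQ {n : ℕ} (F : Phase n → ℝ) (i : Fin n) (x : Phase n) : ℝ :=
  fderiv ℝ F x (0, Pi.single i 1)

/-- The standard Poisson bracket
`{F,G} = Σ i, (∂F/∂q_i · ∂G/∂p_i − ∂F/∂p_i · ∂G/∂q_i)`. -/
noncomputable def poisson {n : ℕ} (F G : Phase n → ℝ) (x : Phase n) : ℝ :=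
  ∑ i : Fin n, (pderivQ F i x * pderivP G i x - pderivP F i x * pderivQ G i x)

/-- `F ∈ C_c^∞(ℝ^{2n})`: smooth and compactly supported. -/
def SmoothCpt {n : ℕ} (F : Phase n → ℝ) : Prop :=
  ContDiff ℝ (⊤ : ℕ∞) F ∧ HasCompactSupport F

/-- The uniform (C⁰) norm `‖F‖ = sup_x |F x|`. -/
noncomputable def unif {n : ℕ} (F : Phase n → ℝ) : ℝ := ⨆ x, |F x|

section Helpers

open MeasureTheory

/-- `det (1 + A) > 0` when `‖A‖ < 1`. -/
lemma det_one_add_pos {V : Type*} [NormedAddCommGroup V] [NormedSpace ℝ V] [FiniteDimensional ℝ V]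
    (A : V →L[ℝ] V) (hA : ‖A‖ < 1) : 0 < (1 + A : V →L[ℝ] V).det := by
  have hcont : Continuous (fun r : ℝ => (1 + r • A : V →L[ℝ] V).det) := by
    have h1 : Continuous (fun B : V →L[ℝ] V => B.det) := ContinuousLinearMap.continuous_det
    exact h1.comp (by fun_prop)
  have hne : ∀ r ∈ Set.Icc (0:ℝ) 1, (1 + r • A : V →L[ℝ] V).det ≠ 0 := by
    intro r hr h0
    have hlt : ‖-(r • A)‖ < 1 := by
      rw [norm_neg, norm_smul, Real.norm_eq_abs, abs_of_nonneg hr.1]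
      nlinarith [norm_nonneg A, hr.2]
    have hu := (Units.oneSub (-(r • A)) hlt).isUnit
    rw [Units.val_oneSub, sub_neg_eq_add] at hu
    have hu2 : IsUnit ((1 + r • A : V →L[ℝ] V) : V →ₗ[ℝ] V) := by
      exact hu.map (ContinuousLinearMap.toLinearMapRingHom (R₁ := ℝ))
    have := LinearMap.isUnit_det _ hu2
    exact this.ne_zero h0
  by_contra hneg
  push Not at hneg
  have := intermediate_value_Icc' (zero_le_one (α := ℝ)) (hcont.continuousOn (s := Set.Icc 0 1))
  have h0 : (0:ℝ) ∈ Set.Icc ((1 + (1:ℝ) • A : V →L[ℝ] V).det) ((1 + (0:ℝ) • A : V →L[ℝ] V).det) := by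
    constructor
    · simpa using hneg
    · simp [ContinuousLinearMap.det]
  obtain ⟨r, hr, hr0⟩ := this h0
  exact hne r hr hr0

/-- Change of variables for small perturbations of the identity. -/
lemma small_change {ι : Type*} [Fintype ι] (u : EuclideanSpace ℝ ι → EuclideanSpace ℝ ι)
    (hu : ContDiff ℝ 1 u) (C : NNReal) (hC : LipschitzWith C u) (R : ℝ)
    (hR : ∀ x, R < ‖x‖ → u x = 0) (t : ℝ) (ht0 : 0 ≤ t) (ht : t * C < 1)
    (φ : EuclideanSpace ℝ ι → ℝ) :
    ∫ x in Metric.closedBall 0 R, (1 + t • fderiv ℝ u x).det * φ (x + t • u x) =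
      ∫ x in Metric.closedBall 0 R, φ x := by
  set f : EuclideanSpace ℝ ι → EuclideanSpace ℝ ι := fun x => x + t • u x with hf
  have happ : ApproximatesLinearOn f
      ((ContinuousLinearEquiv.refl ℝ (EuclideanSpace ℝ ι) : EuclideanSpace ℝ ι ≃L[ℝ] EuclideanSpace ℝ ι) :
        EuclideanSpace ℝ ι →L[ℝ] EuclideanSpace ℝ ι) Set.univ (t.toNNReal * C) := by
    intro x _ y _
    have h1 := hC.dist_le_mul x y
    rw [dist_eq_norm, dist_eq_norm] at h1
    have : f x - f y - (x - y) = t • (u x - u y) := by simp [hf, smul_sub]; abel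
    simp only [ContinuousLinearEquiv.coe_refl, ContinuousLinearMap.coe_id', id]
    rw [this, norm_smul, Real.norm_eq_abs, abs_of_nonneg ht0]
    push_cast
    rw [Real.coe_toNNReal t ht0]
    nlinarith
  have hlt : Subsingleton (EuclideanSpace ℝ ι) ∨ (t.toNNReal * C : NNReal) <
      ‖((ContinuousLinearEquiv.refl ℝ (EuclideanSpace ℝ ι)).symm :
        EuclideanSpace ℝ ι →L[ℝ] EuclideanSpace ℝ ι)‖₊⁻¹ := by
    rcases subsingleton_or_nontrivial (EuclideanSpace ℝ ι) with h | h
    · exact Or.inl h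
    · right
      have : ‖((ContinuousLinearEquiv.refl ℝ (EuclideanSpace ℝ ι)).symm :
        EuclideanSpace ℝ ι →L[ℝ] EuclideanSpace ℝ ι)‖₊ = 1 := by
        apply NNReal.eq; simp
      rw [this, inv_one]
      rw [← NNReal.coe_lt_coe]
      push_cast
      rwa [Real.coe_toNNReal t ht0]
  have hinj : Function.Injective f := Set.injOn_univ.1 (happ.injOn hlt)
  have hsurj : Function.Surjective f := happ.surjective hlt
  have himg : f '' (Metric.closedBall 0 R) = Metric.closedBall 0 R := by
    have hout : ∀ x, R < ‖x‖ → f x = x := fun x hx => by simp [hf, hR x hx]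
    ext y
    simp only [Set.mem_image, mem_closedBall_zero_iff]
    constructor
    · rintro ⟨x, hx, rfl⟩
      by_contra h
      push Not at h
      have := hinj (hout _ h)
      rw [this] at h
      linarith
    · intro hy
      obtain ⟨x, rfl⟩ := hsurj y
      refine ⟨x, ?_, rfl⟩
      by_contra h
      push Not at h
      rw [hout x h] at hy
      linarith
  have hder : ∀ x ∈ Metric.closedBall (0 : EuclideanSpace ℝ ι) R,
      HasFDerivWithinAt f (1 + t • fderiv ℝ u x) (Metric.closedBall 0 R) x := by
    intro x _
    have h1 : HasFDerivAt u (fderiv ℝ u x) x := (hu.differentiable (by norm_num) x).hasFDerivAt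
    exact ((hasFDerivAt_id x).add (h1.const_smul t)).hasFDerivWithinAt
  have key := integral_image_eq_integral_abs_det_fderiv_smul volume
    (Metric.isClosed_closedBall (x := (0 : EuclideanSpace ℝ ι)) (ε := R)).measurableSet hder hinj.injOn φ
  rw [himg] at key
  rw [key]
  refine integral_congr_ae (Filter.Eventually.of_forall fun x => ?_)
  have hpos : 0 < (1 + t • fderiv ℝ u x).det := by
    apply det_one_add_pos
    rw [norm_smul, Real.norm_eq_abs, abs_of_nonneg ht0]
    have : ‖fderiv ℝ u x‖ ≤ C := norm_fderiv_le_of_lipschitz ℝ hC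
    nlinarith
  simp [abs_of_pos hpos, hf]

open Polynomial in
lemma poly_repr {ι : Type*} [Fintype ι] (A : EuclideanSpace ℝ ι →L[ℝ] EuclideanSpace ℝ ι)
    (x w : EuclideanSpace ℝ ι) (S : ℝ) (k : ℕ) :
    ∃ P : ℝ[X], P.natDegree ≤ Fintype.card ι + 2 * k ∧
      ∀ t : ℝ, P.eval t = (1 + t • A).det * (S - ‖x + t • w‖ ^ 2) ^ k := by
  classical
  set b := (EuclideanSpace.basisFun ι ℝ).toBasis
  set M := LinearMap.toMatrix b b (A : EuclideanSpace ℝ ι →ₗ[ℝ] EuclideanSpace ℝ ι)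
  set P1 : ℝ[X] := Matrix.det ((X : ℝ[X]) • M.map C + (1 : Matrix ι ι ℝ).map C)
  set P2 : ℝ[X] := C (S - ‖x‖ ^ 2) - C (2 * inner ℝ x w) * X - C (‖w‖ ^ 2) * X ^ 2
  refine ⟨P1 * P2 ^ k, ?_, ?_⟩
  · have h1 : P1.natDegree ≤ Fintype.card ι := Polynomial.natDegree_det_X_add_C_le M 1
    have h2 : P2.natDegree ≤ 2 := by
      simp only [P2]
      compute_degree
    calc (P1 * P2 ^ k).natDegree ≤ P1.natDegree + (P2 ^ k).natDegree := natDegree_mul_le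
      _ ≤ Fintype.card ι + 2 * k := by
        have := natDegree_pow_le (p := P2) (n := k)
        nlinarith
  · intro t
    have h1 : P1.eval t = (1 + t • A).det := by
      have e1 : (1 + t • A).det = (LinearMap.toMatrix b b
          ((1 + t • A : EuclideanSpace ℝ ι →L[ℝ] EuclideanSpace ℝ ι) :
            EuclideanSpace ℝ ι →ₗ[ℝ] EuclideanSpace ℝ ι)).det := by
        rw [LinearMap.det_toMatrix]
      rw [e1]
      have e2 : LinearMap.toMatrix b b
          ((1 + t • A : EuclideanSpace ℝ ι →L[ℝ] EuclideanSpace ℝ ι) :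
            EuclideanSpace ℝ ι →ₗ[ℝ] EuclideanSpace ℝ ι) = t • M + 1 := by
        have : ((1 + t • A : EuclideanSpace ℝ ι →L[ℝ] EuclideanSpace ℝ ι) :
            EuclideanSpace ℝ ι →ₗ[ℝ] EuclideanSpace ℝ ι) =
            LinearMap.id + t • (A : EuclideanSpace ℝ ι →ₗ[ℝ] EuclideanSpace ℝ ι) := rfl
        rw [this, map_add, map_smul, LinearMap.toMatrix_id, add_comm]
      rw [e2]
      simp only [P1]
      rw [← Polynomial.coe_evalRingHom, RingHom.map_det]
      congr 1
      ext i j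
      by_cases hij : i = j
      · subst hij; simp; ring
      · simp [hij]; ring
    have h2 : P2.eval t = S - ‖x + t • w‖ ^ 2 := by
      rw [norm_add_sq_real]
      simp only [P2, eval_sub, eval_mul, eval_C, eval_X, eval_pow, norm_smul, inner_smul_right,
        mul_pow, Real.norm_eq_abs, sq_abs]
      ring
    rw [eval_mul, eval_pow, h1, h2]

lemma full_change {ι : Type*} [Fintype ι] (u : EuclideanSpace ℝ ι → EuclideanSpace ℝ ι)
    (hu : ContDiff ℝ 1 u) (C : NNReal) (hC : LipschitzWith C u) (R : ℝ)
    (hR : ∀ x, R < ‖x‖ → u x = 0) (S : ℝ) (k : ℕ) :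
    ∫ x in Metric.closedBall 0 R, (1 + fderiv ℝ u x).det * (S - ‖x + u x‖ ^ 2) ^ k =
      ∫ x in Metric.closedBall (0 : EuclideanSpace ℝ ι) R, (S - ‖x‖ ^ 2) ^ k := by
  classical
  set D := Fintype.card ι + 2 * k
  set τ : ℝ := 1 / ((D + 1) * (C + 1))
  have hτ : 0 < τ := by positivity
  set v : ℕ → ℝ := fun i => i * τ
  set s := Finset.range (D + 1)
  have hv : Set.InjOn v s := by
    intro i _ j _ h
    simp only [v] at h
    have := mul_right_cancel₀ hτ.ne' h
    exact_mod_cast this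
  have hsmall : ∀ i ∈ s, ∫ x in Metric.closedBall 0 R,
      (1 + v i • fderiv ℝ u x).det * (S - ‖x + v i • u x‖ ^ 2) ^ k =
      ∫ x in Metric.closedBall (0 : EuclideanSpace ℝ ι) R, (S - ‖x‖ ^ 2) ^ k := by
    intro i hi
    have hvi : 0 ≤ v i := by positivity
    refine small_change u hu C hC R hR (v i) hvi ?_ (fun y => (S - ‖y‖ ^ 2) ^ k)
    have hi' : (i : ℝ) < D + 1 := by
      have := Finset.mem_range.1 hi
      exact_mod_cast this
    simp only [v, τ]
    rw [mul_one_div, div_mul_eq_mul_div, div_lt_one (by positivity)]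
    have : (0:ℝ) ≤ C := C.2
    nlinarith
  have hpt : ∀ x : EuclideanSpace ℝ ι, (1 + fderiv ℝ u x).det * (S - ‖x + u x‖ ^ 2) ^ k =
      ∑ i ∈ s, (Lagrange.basis s v i).eval 1 *
        ((1 + v i • fderiv ℝ u x).det * (S - ‖x + v i • u x‖ ^ 2) ^ k) := by
    intro x
    obtain ⟨P, hP, hPe⟩ := poly_repr (fderiv ℝ u x) x (u x) S k
    have h1 := hPe 1
    rw [one_smul, one_smul] at h1
    rw [← h1]
    have hdeg : P.degree < (s.card : WithBot ℕ) := by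
      refine lt_of_le_of_lt Polynomial.degree_le_natDegree ?_
      rw [Finset.card_range]
      exact_mod_cast Nat.lt_succ_of_le hP
    have := Lagrange.eq_interpolate hv hdeg
    conv_lhs => rw [this]
    rw [Lagrange.interpolate_apply, Polynomial.eval_finsetSum]
    refine Finset.sum_congr rfl fun i _ => ?_
    rw [Polynomial.eval_mul, Polynomial.eval_C, hPe, mul_comm]
  have hcf : Continuous (fderiv ℝ u) := hu.continuous_fderiv (by norm_num)
  have hcu : Continuous u := hu.continuous
  simp_rw [hpt]
  rw [integral_finsetSum]
  · have : ∀ i ∈ s, ∫ x in Metric.closedBall 0 R, (Lagrange.basis s v i).eval 1 *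
        ((1 + v i • fderiv ℝ u x).det * (S - ‖x + v i • u x‖ ^ 2) ^ k) =
        (Lagrange.basis s v i).eval 1 *
          ∫ x in Metric.closedBall (0 : EuclideanSpace ℝ ι) R, (S - ‖x‖ ^ 2) ^ k := by
      intro i hi
      rw [integral_const_mul, hsmall i hi]
    rw [Finset.sum_congr rfl this, ← Finset.sum_mul, ← Polynomial.eval_finsetSum,
      Lagrange.sum_basis hv ⟨0, by simp [s]⟩]
    simp
  · intro i _
    apply ContinuousOn.integrableOn_compact (isCompact_closedBall _ _)
    apply Continuous.continuousOn
    have : Continuous fun x => (1 + v i • fderiv ℝ u x).det :=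
      ContinuousLinearMap.continuous_det.comp (by fun_prop)
    fun_prop

/-- A `C¹` map at bounded distance from a positive multiple of the identity has a zero. -/
lemma exists_zero_aux {ι : Type*} [Fintype ι] (u : EuclideanSpace ℝ ι → EuclideanSpace ℝ ι)
    (hu : ContDiff ℝ 1 u) (hs : HasCompactSupport u) : ∃ x, x + u x = 0 := by
  by_contra hno
  push Not at hno
  obtain ⟨C, hC⟩ := hu.lipschitzWith_of_hasCompactSupport hs (by norm_num)
  obtain ⟨R0, hR0⟩ := hs.isBounded.subset_closedBall 0
  set R := max R0 1
  have hRpos : 0 < R := lt_of_lt_of_le one_pos (le_max_right _ _)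
  have hR : ∀ x, R < ‖x‖ → u x = 0 := by
    intro x hx
    by_contra h
    have := hR0 (subset_tsupport _ (Function.mem_support.2 h))
    rw [mem_closedBall_zero_iff] at this
    linarith [le_max_left R0 1]
  set B := Metric.closedBall (0 : EuclideanSpace ℝ ι) R
  have hB : IsCompact B := isCompact_closedBall _ _
  have hBne : B.Nonempty := ⟨0, by simp [B, hRpos.le]⟩
  have hcu : Continuous u := hu.continuous
  have hcf : Continuous (fderiv ℝ u) := hu.continuous_fderiv (by norm_num)
  have hcdet : Continuous fun x => (1 + fderiv ℝ u x).det :=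
      ContinuousLinearMap.continuous_det.comp (by fun_prop)
  obtain ⟨x1, hx1, hmin⟩ := hB.exists_isMinOn hBne
    (f := fun x => ‖x + u x‖) (by fun_prop)
  obtain ⟨x2, hx2, hmax⟩ := hB.exists_isMaxOn hBne
    (f := fun x => ‖x + u x‖) (by fun_prop)
  obtain ⟨x3, hx3, hmaxd⟩ := hB.exists_isMaxOn hBne
    (f := fun x => |(1 + fderiv ℝ u x).det|) hcdet.abs.continuousOn
  set m0 := ‖x1 + u x1‖
  have hm0 : 0 < m0 := norm_pos_iff.2 (hno x1)
  set S := R ^ 2 + ‖x2 + u x2‖ ^ 2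
  set Dm := |(1 + fderiv ℝ u x3).det|
  have hm0S : m0 ^ 2 ≤ S := by
    have : m0 ≤ ‖x2 + u x2‖ := hmax hx1
    simp only [S]
    nlinarith [sq_nonneg R]
  set r := min (m0 / 2) R
  have hr : 0 < r := lt_min (by linarith) hRpos
  set vB := (volume B).toReal
  set vr := (volume (Metric.closedBall (0 : EuclideanSpace ℝ ι) r)).toReal
  have hvr : 0 < vr := by
    apply ENNReal.toReal_pos
    · exact (Metric.measure_closedBall_pos volume _ hr).ne'
    · exact measure_closedBall_lt_top.ne
  have hineq : ∀ k : ℕ, (S - r ^ 2) ^ k * vr ≤ Dm * (S - m0 ^ 2) ^ k * vB := by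
    intro k
    have hk := full_change u hu C hC R hR S k
    have hle : ∫ x in B, (1 + fderiv ℝ u x).det * (S - ‖x + u x‖ ^ 2) ^ k
        ≤ Dm * (S - m0 ^ 2) ^ k * vB := by
      have := norm_setIntegral_le_of_norm_le_const (μ := volume) (s := B)
        (f := fun x => (1 + fderiv ℝ u x).det * (S - ‖x + u x‖ ^ 2) ^ k)
        (C := Dm * (S - m0 ^ 2) ^ k) measure_closedBall_lt_top ?_
      · exact (le_abs_self _).trans this
      · intro x hx
        have h1 : |(1 + fderiv ℝ u x).det| ≤ Dm := hmaxd hx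
        have h2 : m0 ≤ ‖x + u x‖ := hmin hx
        have h3 : ‖x + u x‖ ≤ ‖x2 + u x2‖ := hmax hx
        have h4 : 0 ≤ S - ‖x + u x‖ ^ 2 := by
          simp only [S]; nlinarith [norm_nonneg (x + u x), sq_nonneg R]
        have h5 : S - ‖x + u x‖ ^ 2 ≤ S - m0 ^ 2 := by nlinarith
        rw [norm_mul, norm_pow, Real.norm_eq_abs, Real.norm_eq_abs, abs_of_nonneg h4]
        gcongr
    have hge : (S - r ^ 2) ^ k * vr ≤ ∫ x in B, (S - ‖x‖ ^ 2) ^ k := by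
      have hsub : Metric.closedBall (0 : EuclideanSpace ℝ ι) r ⊆ B :=
        Metric.closedBall_subset_closedBall (min_le_right _ _)
      have hIntg : IntegrableOn (fun x : EuclideanSpace ℝ ι => (S - ‖x‖ ^ 2) ^ k) B :=
        ContinuousOn.integrableOn_compact hB (by fun_prop)
      have hSr : ∀ x ∈ B, 0 ≤ S - ‖x‖ ^ 2 := by
        intro x hx
        have : ‖x‖ ≤ R := by simpa [B] using hx
        simp only [S]
        nlinarith [norm_nonneg x, sq_nonneg ‖x2 + u x2‖]
      have h1 : ∫ x in Metric.closedBall (0 : EuclideanSpace ℝ ι) r, (S - ‖x‖ ^ 2) ^ k ≤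
          ∫ x in B, (S - ‖x‖ ^ 2) ^ k := by
        apply setIntegral_mono_set hIntg
        · filter_upwards [ae_restrict_mem hB.measurableSet] with x hx
          exact pow_nonneg (hSr x hx) k
        · exact Filter.Eventually.of_forall hsub
      have h2 : ∫ x in Metric.closedBall (0 : EuclideanSpace ℝ ι) r, (S - r ^ 2) ^ k ≤
          ∫ x in Metric.closedBall (0 : EuclideanSpace ℝ ι) r, (S - ‖x‖ ^ 2) ^ k := by
        apply setIntegral_mono_on
        · exact integrableOn_const measure_closedBall_lt_top.ne
        · exact hIntg.mono_set hsub
        · exact Metric.isClosed_closedBall.measurableSet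
        · intro x hx
          have hx' : ‖x‖ ≤ r := by simpa using hx
          have : 0 ≤ S - r ^ 2 := by
            have : r ≤ R := min_le_right _ _
            simp only [S]
            nlinarith [sq_nonneg ‖x2 + u x2‖]
          have : S - r ^ 2 ≤ S - ‖x‖ ^ 2 := by nlinarith [norm_nonneg x]
          gcongr
      rw [setIntegral_const, smul_eq_mul, mul_comm] at h2
      exact h2.trans h1
    rw [hk] at hle
    exact hge.trans hle
  have hq : S - m0 ^ 2 < S - r ^ 2 := by
    have : r ≤ m0 / 2 := min_le_left _ _
    nlinarith
  have hq0 : 0 ≤ S - m0 ^ 2 := by linarith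
  have hqp : 0 < S - r ^ 2 := by linarith
  set q := (S - m0 ^ 2) / (S - r ^ 2)
  have hq1 : q < 1 := (div_lt_one hqp).2 hq
  have hqn : 0 ≤ q := div_nonneg hq0 hqp.le
  have hlim := (tendsto_pow_atTop_nhds_zero_of_lt_one hqn hq1).const_mul (Dm * vB)
  rw [mul_zero] at hlim
  obtain ⟨k, hk⟩ := (hlim.eventually (gt_mem_nhds hvr)).exists
  have h1 := hineq k
  have h2 : (S - m0 ^ 2) ^ k = q ^ k * (S - r ^ 2) ^ k := by
    rw [← mul_pow]; congr 1; simp only [q]; field_simp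
  rw [h2] at h1
  have h3 : 0 < (S - r ^ 2) ^ k := pow_pos hqp k
  nlinarith

lemma exists_zero {ι : Type*} [Fintype ι] (φ : EuclideanSpace ℝ ι → EuclideanSpace ℝ ι)
    (hφ : ContDiff ℝ 1 φ) (c : ℝ) (hc : 0 < c) (K : ℝ) (hK : ∀ v, ‖φ v - c • v‖ ≤ K) :
    ∃ v, φ v = 0 := by
  have hK0 : 0 ≤ K := (norm_nonneg _).trans (hK 0)
  let χ : ContDiffBump (0 : EuclideanSpace ℝ ι) := ⟨K / c + 1, K / c + 2, by positivity, by linarith⟩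
  obtain ⟨x, hx⟩ := exists_zero_aux (fun v => χ v • (c⁻¹ • φ v - v))
    (χ.contDiff.smul ((hφ.const_smul _).sub contDiff_id)) (χ.hasCompactSupport.smul_right)
  refine ⟨x, ?_⟩
  have hb : ‖c⁻¹ • φ x - x‖ ≤ K / c := by
    have : c⁻¹ • φ x - x = c⁻¹ • (φ x - c • x) := by
      rw [smul_sub, smul_smul, inv_mul_cancel₀ hc.ne', one_smul]
    rw [this, norm_smul, norm_inv, Real.norm_eq_abs, abs_of_pos hc, div_eq_inv_mul]
    gcongr
    exact hK x
  have hxn : ‖x‖ ≤ K / c := by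
    have : x = -(χ x • (c⁻¹ • φ x - x)) := eq_neg_of_add_eq_zero_left hx
    rw [this, norm_neg, norm_smul, Real.norm_eq_abs, abs_of_nonneg χ.nonneg]
    calc χ x * ‖c⁻¹ • φ x - x‖ ≤ 1 * ‖c⁻¹ • φ x - x‖ := by gcongr; exact χ.le_one
      _ ≤ _ := by rw [one_mul]; exact hb
  have h1 : χ x = 1 := χ.one_of_mem_closedBall (by
    rw [mem_closedBall_zero_iff]; show ‖x‖ ≤ K / c + 1; linarith)
  simp only [h1, one_smul, add_sub_cancel] at hx
  rcases smul_eq_zero.1 hx with h | h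
  · exact absurd h (inv_ne_zero hc.ne')
  · exact h

/-- The minimax class: some `C¹` family `h`, whose `P`-component is at bounded distance from a
positive multiple of the identity, along which `f ≥ a`. -/
def Linked {ι : Type*} [Fintype ι] {E : Type*} [NormedAddCommGroup E] [InnerProductSpace ℝ E]
    (P : E →L[ℝ] EuclideanSpace ℝ ι) (f : E → ℝ) (a : ℝ) : Prop :=
  ∃ h : EuclideanSpace ℝ ι → E, ContDiff ℝ 1 h ∧
    (∃ c > (0:ℝ), ∃ K : ℝ, ∀ v, ‖P (h v) - c • v‖ ≤ K) ∧ ∀ v, a ≤ f (h v)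

lemma Linked.mono {ι : Type*} [Fintype ι] {E : Type*} [NormedAddCommGroup E]
    [InnerProductSpace ℝ E] {P : E →L[ℝ] EuclideanSpace ℝ ι} {f f' : E → ℝ} {a a' : ℝ}
    (h : Linked P f a) (h' : ∀ z, f z - f' z ≤ a - a') : Linked P f' a' := by
  obtain ⟨h, h1, h2, h3⟩ := h
  exact ⟨h, h1, h2, fun v => by linarith [h3 v, h' (h v)]⟩

lemma Linked.nonpos {ι : Type*} [Fintype ι] {E : Type*} [NormedAddCommGroup E]
    [InnerProductSpace ℝ E] {P : E →L[ℝ] EuclideanSpace ℝ ι} {f : E → ℝ} {a : ℝ}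
    (h : Linked P f a) (h' : ∀ z, P z = 0 → f z ≤ 0) : a ≤ 0 := by
  obtain ⟨h, h1, ⟨c, hc, K, hK⟩, h3⟩ := h
  obtain ⟨v, hv⟩ := exists_zero (fun v => P (h v)) (P.contDiff.comp h1) c hc K hK
  exact (h3 v).trans (h' _ hv)

lemma Linked.step {ι : Type*} [Fintype ι] {E : Type*} [NormedAddCommGroup E]
    [InnerProductSpace ℝ E] {P : E →L[ℝ] EuclideanSpace ℝ ι} {L : E →L[ℝ] E}
    (hPL : ∀ z, P (L z) = P z) {f g : E → ℝ} {β : E → E} (hβ : ContDiff ℝ 1 β)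
    {Cβ : ℝ} (hCβ : ∀ z, ‖β z‖ ≤ Cβ) {Kc : ℝ}
    (hasc : ∀ z ξ, f z + inner ℝ (L z + β z) ξ - Kc * ‖ξ‖ ^ 2 ≤ f (z + ξ))
    {C0 Lg κ μ μ' τ Δ a : ℝ} (hC0 : ∀ z, |g z| ≤ C0) (hLg : ∀ z z', |g z - g z'| ≤ Lg * ‖z - z'‖)
    (hLg0 : 0 ≤ Lg) (hκ0 : 0 < κ) (hκ : ∀ z, ‖L z + β z‖ < κ → g z ≤ μ)
    (hτ : 0 < τ) (hτK : τ * Kc ≤ 1 / 2) (hτL : Lg * (τ * κ) ≤ μ' - μ)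
    (hΔ : 0 ≤ Δ) (hΔτ : Δ * (C0 + |μ'|) ≤ τ * κ ^ 2 / 2)
    (h : Linked P f a) : Linked P (fun z => f z - Δ * g z) (a - Δ * μ') := by
  obtain ⟨h, h1, ⟨c, hc, K, hK⟩, h3⟩ := h
  refine ⟨fun v => h v + τ • (L (h v) + β (h v)), ?_, ⟨(1 + τ) * c, by positivity,
    (1 + τ) * K + τ * (‖P‖ * Cβ), ?_⟩, ?_⟩
  · exact h1.add (((L.contDiff.comp h1).add (hβ.comp h1)).const_smul τ)
  · intro v
    have e : P (h v + τ • (L (h v) + β (h v))) - ((1 + τ) * c) • v =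
        (1 + τ) • (P (h v) - c • v) + τ • P (β (h v)) := by
      rw [map_add, map_smul, map_add, hPL]
      module
    rw [e]
    refine (norm_add_le _ _).trans ?_
    rw [norm_smul, norm_smul, Real.norm_eq_abs, Real.norm_eq_abs, abs_of_pos hτ,
      abs_of_pos (by positivity : 0 < 1 + τ)]
    have := hK v
    have h4 : ‖P (β (h v))‖ ≤ ‖P‖ * Cβ :=
      (P.le_opNorm _).trans (mul_le_mul_of_nonneg_left (hCβ _) (norm_nonneg _))
    gcongr
  · intro v
    set z := h v
    set w := L z + β z with hw
    have h4 := hasc z (τ • w)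
    rw [← hw, inner_smul_right, real_inner_self_eq_norm_sq, norm_smul, Real.norm_eq_abs,
      abs_of_pos hτ] at h4
    have h5 := h3 v
    have h6 := hC0 (z + τ • w)
    have h7 : τ * ‖w‖ ^ 2 / 2 ≤ τ * ‖w‖ ^ 2 - Kc * (τ * ‖w‖) ^ 2 := by
      have : Kc * (τ * ‖w‖) ^ 2 = (τ * Kc) * (τ * ‖w‖ ^ 2) := by ring
      rw [this]
      nlinarith [mul_nonneg hτ.le (sq_nonneg ‖w‖)]
    rcases lt_or_ge ‖w‖ κ with hlt | hge
    · have h8 := hκ z hlt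
      have h9 := hLg (z + τ • w) z
      rw [add_sub_cancel_left, norm_smul, Real.norm_eq_abs, abs_of_pos hτ] at h9
      have h10 : Lg * (τ * ‖w‖) ≤ Lg * (τ * κ) := by gcongr
      have h11 : g (z + τ • w) ≤ μ' := by linarith [le_abs_self (g (z + τ • w) - g z)]
      have h12 : Δ * g (z + τ • w) ≤ Δ * μ' := mul_le_mul_of_nonneg_left h11 hΔ
      have h13 : 0 ≤ τ * ‖w‖ ^ 2 / 2 := by positivity
      linarith
    · have h8 : τ * κ ^ 2 / 2 ≤ τ * ‖w‖ ^ 2 / 2 := by gcongr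
      have h9 : Δ * g (z + τ • w) ≤ Δ * C0 :=
        mul_le_mul_of_nonneg_left ((le_abs_self _).trans h6) hΔ
      have h10 : -(Δ * μ') ≤ Δ * |μ'| := by
        have := mul_le_mul_of_nonneg_left (neg_abs_le μ') hΔ
        linarith
      linarith

lemma Linked.descend {ι : Type*} [Fintype ι] {E : Type*} [NormedAddCommGroup E]
    [InnerProductSpace ℝ E] {P : E →L[ℝ] EuclideanSpace ℝ ι} {L : E →L[ℝ] E}
    (hPL : ∀ z, P (L z) = P z) {f g : E → ℝ} {β γ : E → E} (hβ : ContDiff ℝ 1 β)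
    (hγ : ContDiff ℝ 1 γ)
    {Cβ Cγ : ℝ} (hCβ : ∀ z, ‖β z‖ ≤ Cβ) (hCγ : ∀ z, ‖γ z‖ ≤ Cγ) {Kc : ℝ} {T : ℝ} (hT : 0 ≤ T)
    (hasc : ∀ t ∈ Set.Icc 0 T, ∀ z ξ, f z + t * g z + inner ℝ (L z + (β z + t • γ z)) ξ
      - Kc * ‖ξ‖ ^ 2 ≤ f (z + ξ) + t * g (z + ξ))
    {C0 Lg κ μ μ' a : ℝ} (hC0 : ∀ z, |g z| ≤ C0) (hLg : ∀ z z', |g z - g z'| ≤ Lg * ‖z - z'‖)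
    (hLg0 : 0 ≤ Lg) (hκ0 : 0 < κ)
    (hκ : ∀ t ∈ Set.Icc 0 T, ∀ z, ‖L z + (β z + t • γ z)‖ < κ → g z ≤ μ)
    (hμ : μ < μ')
    (h : Linked P (fun z => f z + T * g z) a) : Linked P f (a - T * μ') := by
  have hC00 : 0 ≤ C0 := (abs_nonneg _).trans (hC0 0)
  obtain ⟨τ, hτ, hτK, hτL⟩ : ∃ τ > (0:ℝ), τ * Kc ≤ 1 / 2 ∧ Lg * (τ * κ) ≤ μ' - μ := by
    have hd : 0 < μ' - μ := sub_pos.2 hμ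
    refine ⟨min (1 / (2 * (|Kc| + 1))) ((μ' - μ) / ((Lg + 1) * κ)), by positivity, ?_, ?_⟩
    · have h1 : min (1 / (2 * (|Kc| + 1))) ((μ' - μ) / ((Lg + 1) * κ)) * Kc ≤
        (1 / (2 * (|Kc| + 1))) * (|Kc| + 1) := by
        refine mul_le_mul_of_nonneg_left ((le_abs_self Kc).trans (le_add_of_nonneg_right zero_le_one))
          (by positivity) |>.trans ?_
        exact mul_le_mul_of_nonneg_right (min_le_left _ _) (by positivity)
      refine h1.trans (le_of_eq ?_)
      field_simp
    · have h1 : Lg * (min (1 / (2 * (|Kc| + 1))) ((μ' - μ) / ((Lg + 1) * κ)) * κ) ≤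
        (Lg + 1) * ((μ' - μ) / ((Lg + 1) * κ) * κ) := by
        gcongr
        · linarith
        · exact min_le_right _ _
      refine h1.trans (le_of_eq ?_)
      field_simp
  obtain ⟨n, hn⟩ := exists_nat_gt (T * (C0 + |μ'|) / (τ * κ ^ 2 / 2))
  have hn0 : (0:ℝ) < n := lt_of_le_of_lt (by positivity) hn
  set Δ := T / n with hΔdef
  have hΔ : 0 ≤ Δ := by positivity
  have hΔτ : Δ * (C0 + |μ'|) ≤ τ * κ ^ 2 / 2 := by
    rw [div_lt_iff₀ (by positivity)] at hn
    rw [hΔdef, div_mul_eq_mul_div, div_le_iff₀ hn0]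
    linarith
  have hind : ∀ k : ℕ, k ≤ n → Linked P (fun z => f z + (T - k * Δ) * g z) (a - k * Δ * μ') := by
    intro k
    induction k with
    | zero => intro _; simpa using h
    | succ k ih =>
      intro hk
      have h1 := ih (by omega)
      have hkn : (k:ℝ) ≤ n := by exact_mod_cast (by omega : k ≤ n)
      have ht : T - k * Δ ∈ Set.Icc 0 T := by
        have : k * Δ ≤ T := by
          calc k * Δ ≤ n * Δ := by gcongr
            _ = T := by rw [hΔdef]; field_simp
        constructor
        · linarith
        · linarith [mul_nonneg (Nat.cast_nonneg (α := ℝ) k) hΔ]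
      have h2 := h1.step (L := L) hPL (β := fun z => β z + (T - k * Δ) • γ z)
        (hβ.add (hγ.const_smul _)) (Cβ := Cβ + |T - k * Δ| * Cγ) (fun z => by
          refine (norm_add_le _ _).trans ?_
          rw [norm_smul, Real.norm_eq_abs]
          have := hCβ z
          have := hCγ z
          gcongr) (hasc _ ht) hC0 hLg hLg0 hκ0 (hκ _ ht) hτ hτK hτL hΔ hΔτ
      refine h2.mono fun z => le_of_eq ?_
      push_cast
      ring
  have h1 := hind n le_rfl
  have hnΔ : n * Δ = T := by rw [hΔdef]; field_simp
  rw [hnΔ] at h1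
  simpa using h1

/-- Smooth functions which are bounded with bounded and Lipschitz derivative. -/
def Nice {E : Type*} [NormedAddCommGroup E] [NormedSpace ℝ E] (φ : E → ℝ) (C : ℝ) : Prop :=
  ContDiff ℝ 2 φ ∧ 0 ≤ C ∧ (∀ z, |φ z| ≤ C) ∧ (∀ z, ‖fderiv ℝ φ z‖ ≤ C) ∧
    ∀ z w, ‖fderiv ℝ φ z - fderiv ℝ φ w‖ ≤ C * ‖z - w‖

lemma Nice.const_mul {E : Type*} [NormedAddCommGroup E] [NormedSpace ℝ E] {φ : E → ℝ} {C : ℝ}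
    (h : Nice φ C) (c : ℝ) : Nice (fun z => c * φ z) (|c| * C) := by
  obtain ⟨h1, h2, h3, h4, h5⟩ := h
  have hd : ∀ z, fderiv ℝ (fun z => c * φ z) z = c • fderiv ℝ φ z := fun z =>
    fderiv_const_mul (h1.differentiable (by norm_num) z) c
  refine ⟨contDiff_const.mul h1, by positivity, fun z => ?_, fun z => ?_, fun z w => ?_⟩
  · rw [abs_mul]; exact mul_le_mul_of_nonneg_left (h3 z) (abs_nonneg c)
  · rw [hd, norm_smul, Real.norm_eq_abs]; exact mul_le_mul_of_nonneg_left (h4 z) (abs_nonneg c)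
  · rw [hd, hd, ← smul_sub, norm_smul, Real.norm_eq_abs, mul_assoc]
    exact mul_le_mul_of_nonneg_left (h5 z w) (abs_nonneg c)

lemma Nice.add {E : Type*} [NormedAddCommGroup E] [NormedSpace ℝ E] {φ ψ : E → ℝ} {C D : ℝ}
    (h : Nice φ C) (h' : Nice ψ D) : Nice (fun z => φ z + ψ z) (C + D) := by
  obtain ⟨h1, h2, h3, h4, h5⟩ := h
  obtain ⟨k1, k2, k3, k4, k5⟩ := h'
  have hd : ∀ z, fderiv ℝ (fun z => φ z + ψ z) z = fderiv ℝ φ z + fderiv ℝ ψ z := fun z =>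
    fderiv_fun_add (h1.differentiable (by norm_num) z) (k1.differentiable (by norm_num) z)
  refine ⟨h1.add k1, by positivity, fun z => ?_, fun z => ?_, fun z w => ?_⟩
  · exact (abs_add_le _ _).trans (add_le_add (h3 z) (k3 z))
  · rw [hd]; exact (norm_add_le _ _).trans (add_le_add (h4 z) (k4 z))
  · rw [hd, hd, add_sub_add_comm, add_mul]
    exact (norm_add_le _ _).trans (add_le_add (h5 z w) (k5 z w))

lemma Nice.comp_affine {E F : Type*} [NormedAddCommGroup E] [NormedSpace ℝ E]
    [NormedAddCommGroup F] [NormedSpace ℝ F] {φ : F → ℝ} {C : ℝ}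
    (h : Nice φ C) (x : F) (l : E →L[ℝ] F) :
    Nice (fun z => φ (x + l z)) (C * (1 + ‖l‖) ^ 2) := by
  obtain ⟨h1, h2, h3, h4, h5⟩ := h
  have hd : ∀ z, fderiv ℝ (fun z => φ (x + l z)) z = (fderiv ℝ φ (x + l z)).comp l := fun z => by
    have e1 : HasFDerivAt (fun z => x + l z) l z := l.hasFDerivAt.const_add x
    have e2 := (h1.differentiable (by norm_num) (x + l z)).hasFDerivAt
    exact (e2.comp z e1).fderiv
  have hl := norm_nonneg l
  refine ⟨h1.comp (contDiff_const.add l.contDiff), by positivity, fun z => ?_, fun z => ?_,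
    fun z w => ?_⟩
  · refine (h3 _).trans ?_
    nlinarith [mul_nonneg h2 hl, mul_nonneg h2 (mul_nonneg hl hl)]
  · rw [hd]
    refine (ContinuousLinearMap.opNorm_comp_le _ _).trans ?_
    have := mul_le_mul_of_nonneg_right (h4 (x + l z)) hl
    nlinarith [mul_nonneg h2 hl, mul_nonneg h2 (mul_nonneg hl hl)]
  · rw [hd, hd, ← ContinuousLinearMap.sub_comp]
    refine (ContinuousLinearMap.opNorm_comp_le _ _).trans ?_
    have e1 := h5 (x + l z) (x + l w)
    rw [add_sub_add_left_eq_sub, ← map_sub] at e1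
    have e2 := l.le_opNorm (z - w)
    have e3 : ‖fderiv ℝ φ (x + l z) - fderiv ℝ φ (x + l w)‖ ≤ C * (‖l‖ * ‖z - w‖) :=
      e1.trans (mul_le_mul_of_nonneg_left e2 h2)
    calc _ ≤ C * (‖l‖ * ‖z - w‖) * ‖l‖ := mul_le_mul_of_nonneg_right e3 hl
      _ = C * ‖l‖ ^ 2 * ‖z - w‖ := by ring
      _ ≤ C * (1 + ‖l‖) ^ 2 * ‖z - w‖ := by gcongr; linarith

lemma Nice.taylor {E : Type*} [NormedAddCommGroup E] [NormedSpace ℝ E] {φ : E → ℝ} {C : ℝ}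
    (h : Nice φ C) {x y w : E} {r : ℝ} (hx : ‖x - w‖ ≤ r) (hy : ‖y - w‖ ≤ r) :
    |φ y - φ x - fderiv ℝ φ w (y - x)| ≤ C * r * ‖y - x‖ := by
  obtain ⟨h1, h2, h3, h4, h5⟩ := h
  refine (convex_closedBall w r).norm_image_sub_le_of_norm_fderiv_le' (𝕜 := ℝ)
    (fun z _ => h1.differentiable (by norm_num) z) (fun z hz => ?_) ?_ ?_
  · refine (h5 z w).trans (mul_le_mul_of_nonneg_left ?_ h2)
    rwa [Metric.mem_closedBall, dist_eq_norm] at hz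
  · rwa [Metric.mem_closedBall, dist_eq_norm]
  · rwa [Metric.mem_closedBall, dist_eq_norm]

lemma Nice.lip {E : Type*} [NormedAddCommGroup E] [NormedSpace ℝ E] {φ : E → ℝ} {C : ℝ}
    (h : Nice φ C) (x y : E) : |φ y - φ x| ≤ C * ‖y - x‖ :=
  convex_univ.norm_image_sub_le_of_norm_fderiv_le (𝕜 := ℝ)
    (fun z _ => h.1.differentiable (by norm_num) z) (fun z _ => h.2.2.2.1 z) trivial trivial

lemma SmoothCpt.nice {n : ℕ} {F : Phase n → ℝ} (hF : SmoothCpt F) : ∃ C, Nice F C := by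
  obtain ⟨h1, h2⟩ := hF
  have h1' : ContDiff ℝ 2 F := contDiff_infty.1 h1 2
  have hd : ContDiff ℝ 1 (fderiv ℝ F) := h1'.fderiv_right (by norm_num)
  have hdc : HasCompactSupport (fderiv ℝ F) := h2.fderiv ℝ
  obtain ⟨C1, hC1⟩ := h1.continuous.bounded_above_of_compact_support h2
  obtain ⟨C2, hC2⟩ := hd.continuous.bounded_above_of_compact_support hdc
  obtain ⟨C3, hC3⟩ := hd.lipschitzWith_of_hasCompactSupport hdc (by norm_num)
  refine ⟨max C1 (max C2 C3), h1', ?_, ?_, ?_, ?_⟩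
  · exact C3.2.trans ((le_max_right _ _).trans (le_max_right _ _))
  · exact fun z => (hC1 z).trans (le_max_left _ _)
  · exact fun z => (hC2 z).trans ((le_max_left _ _).trans (le_max_right _ _))
  · intro z w
    have := hC3.dist_le_mul z w
    rw [dist_eq_norm, dist_eq_norm] at this
    refine this.trans (mul_le_mul_of_nonneg_right ?_ (norm_nonneg _))
    exact (le_max_right _ _).trans (le_max_right _ _)

lemma Nice.gradient_facts {E : Type*} [NormedAddCommGroup E] [InnerProductSpace ℝ E]
    [CompleteSpace E] {φ : E → ℝ} {C : ℝ}
    (h : Nice φ C) : ContDiff ℝ 1 (gradient φ) ∧ (∀ z, ‖gradient φ z‖ ≤ C) ∧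
      (∀ z ξ, inner ℝ (gradient φ z) ξ = fderiv ℝ φ z ξ) ∧
      ∀ z ξ, |φ (z + ξ) - φ z - inner ℝ (gradient φ z) ξ| ≤ C * ‖ξ‖ ^ 2 := by
  have hi : ∀ z ξ, inner ℝ (gradient φ z) ξ = fderiv ℝ φ z ξ := fun z ξ => by
    rw [inner_gradient_left]
  refine ⟨?_, ?_, hi, ?_⟩
  · have hd : ContDiff ℝ 1 (fderiv ℝ φ) := h.1.fderiv_right (by norm_num)
    exact ((InnerProductSpace.toDual ℝ E).symm.contDiff).comp hd
  · intro z
    have : ‖gradient φ z‖ = ‖fderiv ℝ φ z‖ := (InnerProductSpace.toDual ℝ E).symm.norm_map _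
    rw [this]
    exact h.2.2.2.1 z
  · intro z ξ
    rw [hi]
    have := h.taylor (x := z) (y := z + ξ) (w := z) (r := ‖ξ‖) (by simp) (by simp)
    rw [add_sub_cancel_left] at this
    rw [pow_two, ← mul_assoc]
    exact this

/-- Discrete paths: one half of the coordinates. -/
abbrev VV (m n : ℕ) := EuclideanSpace ℝ (Fin m × Fin n)

/-- The space of discrete paths, momenta and velocities. -/
abbrev EE (m n : ℕ) := WithLp 2 (VV m n × VV m n)

noncomputable def fstL (m n : ℕ) : EE m n →L[ℝ] VV m n := WithLp.fstL 2 ℝ (VV m n) (VV m n)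
noncomputable def sndL (m n : ℕ) : EE m n →L[ℝ] VV m n := WithLp.sndL 2 ℝ (VV m n) (VV m n)

/-- The swap of momenta and velocities. -/
noncomputable def swapL (m n : ℕ) : EE m n →L[ℝ] EE m n :=
  (WithLp.prodContinuousLinearEquiv 2 ℝ (VV m n) (VV m n)).symm.toContinuousLinearMap.comp
    ((sndL m n).prod (fstL m n))

noncomputable def sumL (m n : ℕ) : EE m n →L[ℝ] VV m n := fstL m n + sndL m n

/-- The quadratic part of the action. -/
noncomputable def QQ {m n : ℕ} (z : EE m n) : ℝ := inner ℝ (fstL m n z) (sndL m n z)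

lemma fst_swap {m n : ℕ} (z : EE m n) : fstL m n (swapL m n z) = sndL m n z := rfl
lemma snd_swap {m n : ℕ} (z : EE m n) : sndL m n (swapL m n z) = fstL m n z := rfl

lemma sum_swap {m n : ℕ} (z : EE m n) : sumL m n (swapL m n z) = sumL m n z := by
  simp only [sumL, add_apply, fst_swap, snd_swap, add_comm]

lemma inner_EE {m n : ℕ} (z w : EE m n) : inner ℝ z w =
    inner ℝ (fstL m n z) (fstL m n w) + inner ℝ (sndL m n z) (sndL m n w) :=
  WithLp.prod_inner_apply z w

lemma norm_sq_EE {m n : ℕ} (z : EE m n) : ‖z‖ ^ 2 = ‖fstL m n z‖ ^ 2 + ‖sndL m n z‖ ^ 2 := by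
  rw [← real_inner_self_eq_norm_sq, inner_EE, real_inner_self_eq_norm_sq,
    real_inner_self_eq_norm_sq]

lemma QQ_add {m n : ℕ} (z w : EE m n) :
    QQ (z + w) = QQ z + inner ℝ (swapL m n z) w + QQ w := by
  rw [inner_EE, fst_swap, snd_swap]
  simp only [QQ, map_add, inner_add_left, inner_add_right]
  rw [real_inner_comm (fstL m n w) (sndL m n z)]
  ring

lemma inner_swap_self {m n : ℕ} (z : EE m n) : inner ℝ (swapL m n z) z = 2 * QQ z := by
  rw [inner_EE, fst_swap, snd_swap, QQ, real_inner_comm (fstL m n z) (sndL m n z)]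
  ring

lemma QQ_ge {m n : ℕ} (z : EE m n) : - ‖z‖ ^ 2 ≤ QQ z := by
  rw [norm_sq_EE, QQ]
  have := abs_real_inner_le_norm (fstL m n z) (sndL m n z)
  have := neg_abs_le (inner ℝ (fstL m n z) (sndL m n z))
  nlinarith [sq_nonneg (‖fstL m n z‖ - ‖sndL m n z‖), sq_nonneg ‖fstL m n z‖,
    sq_nonneg ‖sndL m n z‖]

lemma QQ_nonpos {m n : ℕ} (z : EE m n) (h : sumL m n z = 0) : QQ z ≤ 0 := by
  have : fstL m n z = - sndL m n z := eq_neg_of_add_eq_zero_left h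
  rw [QQ, this, inner_neg_left, real_inner_self_eq_norm_sq]
  nlinarith [sq_nonneg ‖sndL m n z‖]

noncomputable def cX {m n : ℕ} (z : EE m n) (k : ℕ) (i : Fin n) : ℝ :=
  if h : k < m then fstL m n z (⟨k, h⟩, i) else 0

noncomputable def cY {m n : ℕ} (z : EE m n) (k : ℕ) (i : Fin n) : ℝ :=
  if h : k < m then sndL m n z (⟨k, h⟩, i) else 0

noncomputable def mkE {m n : ℕ} (x y : ℕ → Fin n → ℝ) : EE m n :=
  WithLp.toLp 2 (WithLp.toLp 2 fun k => x k.1 k.2, WithLp.toLp 2 fun k => y k.1 k.2)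

lemma cX_mk {m n : ℕ} (x y : ℕ → Fin n → ℝ) {k : ℕ} (hk : k < m) (i : Fin n) :
    cX (mkE x y : EE m n) k i = x k i := by
  rw [cX, dif_pos hk]; rfl

lemma cY_mk {m n : ℕ} (x y : ℕ → Fin n → ℝ) {k : ℕ} (hk : k < m) (i : Fin n) :
    cY (mkE x y : EE m n) k i = y k i := by
  rw [cY, dif_pos hk]; rfl

lemma inner_fst {m n : ℕ} (u v : VV m n) : inner ℝ u v =
    ∑ k : Fin m, ∑ i, u (k, i) * v (k, i) := by
  rw [PiLp.inner_apply, Fintype.sum_prod_type]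
  simp [mul_comm]

lemma inner_XX {m n : ℕ} (z w : EE m n) : inner ℝ (fstL m n z) (fstL m n w) =
    ∑ k ∈ Finset.range m, ∑ i, cX z k i * cX w k i := by
  rw [inner_fst, Finset.sum_range]
  simp [cX]

lemma inner_XY {m n : ℕ} (z w : EE m n) : inner ℝ (fstL m n z) (sndL m n w) =
    ∑ k ∈ Finset.range m, ∑ i, cX z k i * cY w k i := by
  rw [inner_fst, Finset.sum_range]
  simp [cX, cY]

lemma inner_YY {m n : ℕ} (z w : EE m n) : inner ℝ (sndL m n z) (sndL m n w) =
    ∑ k ∈ Finset.range m, ∑ i, cY z k i * cY w k i := by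
  rw [inner_fst, Finset.sum_range]
  simp [cY]

lemma inner_swap {m n : ℕ} (z w : EE m n) : inner ℝ (swapL m n z) w =
    ∑ k ∈ Finset.range m, ∑ i, cY z k i * cX w k i +
    ∑ k ∈ Finset.range m, ∑ i, cX z k i * cY w k i := by
  rw [inner_EE, fst_swap, snd_swap, real_inner_comm, inner_XY, inner_XY]
  simp only [mul_comm]

lemma cX_add {m n : ℕ} (z w : EE m n) (k : ℕ) (i : Fin n) :
    cX (z + w) k i = cX z k i + cX w k i := by
  simp only [cX, map_add]
  split_ifs <;> simp

lemma cX_smul {m n : ℕ} (c : ℝ) (z : EE m n) (k : ℕ) (i : Fin n) :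
    cX (c • z) k i = c * cX z k i := by
  simp only [cX, map_smul]
  split_ifs <;> simp

lemma cY_add {m n : ℕ} (z w : EE m n) (k : ℕ) (i : Fin n) :
    cY (z + w) k i = cY z k i + cY w k i := by
  simp only [cY, map_add]
  split_ifs <;> simp

lemma cY_smul {m n : ℕ} (c : ℝ) (z : EE m n) (k : ℕ) (i : Fin n) :
    cY (c • z) k i = c * cY z k i := by
  simp only [cY, map_smul]
  split_ifs <;> simp

lemma cX_cont {m n : ℕ} (k : ℕ) (i : Fin n) : Continuous fun z : EE m n => cX z k i := by
  simp only [cX]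
  split_ifs with h
  · exact (EuclideanSpace.proj (𝕜 := ℝ) ((⟨k, h⟩, i) : Fin m × Fin n)).continuous.comp (fstL m n).continuous
  · exact continuous_const

lemma cY_cont {m n : ℕ} (k : ℕ) (i : Fin n) : Continuous fun z : EE m n => cY z k i := by
  simp only [cY]
  split_ifs with h
  · exact (EuclideanSpace.proj (𝕜 := ℝ) ((⟨k, h⟩, i) : Fin m × Fin n)).continuous.comp (sndL m n).continuous
  · exact continuous_const

/-- The `j`-th point of the discrete path, relative to the base point. -/
noncomputable def lamL (m n : ℕ) (j : ℕ) : EE m n →ₗ[ℝ] Phase n where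
  toFun z := (fun i => cX z j i, fun i => (1 / (m : ℝ)) * ∑ k ∈ Finset.range j, cY z k i)
  map_add' z w := by
    ext i
    · simp only [cX_add, Prod.mk_add_mk, Pi.add_apply]
    · simp only [cY_add, Prod.mk_add_mk, Pi.add_apply, Finset.sum_add_distrib, mul_add]
  map_smul' c z := by
    ext i
    · simp only [cX_smul, RingHom.id_apply, Prod.smul_mk, Pi.smul_apply, smul_eq_mul]
    · simp only [cY_smul, RingHom.id_apply, Prod.smul_mk, Pi.smul_apply, smul_eq_mul,
        ← Finset.mul_sum]
      ring

noncomputable def lam (m n : ℕ) (j : ℕ) : EE m n →L[ℝ] Phase n :=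
  ⟨lamL m n j, (continuous_pi fun i => cX_cont j i).prodMk (continuous_pi fun i =>
    continuous_const.mul (continuous_finsetSum _ fun k _ => cY_cont k i))⟩

lemma lam_apply {m n j : ℕ} (z : EE m n) : lam m n j z =
    (fun i => cX z j i, fun i => (1 / (m : ℝ)) * ∑ k ∈ Finset.range j, cY z k i) := rfl

/-- Total size of a path. -/
lemma sum_lam_sq {m n : ℕ} (z : EE m n) :
    ∑ j ∈ Finset.range m, ‖lam m n j z‖ ^ 2 ≤ ‖z‖ ^ 2 := by
  have hX : ‖fstL m n z‖ ^ 2 = ∑ k ∈ Finset.range m, ∑ i, cX z k i ^ 2 := by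
    rw [← real_inner_self_eq_norm_sq, inner_XX]; simp only [pow_two]
  have hY : ‖sndL m n z‖ ^ 2 = ∑ k ∈ Finset.range m, ∑ i, cY z k i ^ 2 := by
    rw [← real_inner_self_eq_norm_sq, inner_YY]; simp only [pow_two]
  have key : ∀ j ∈ Finset.range m, ‖lam m n j z‖ ^ 2 ≤
      ∑ i, cX z j i ^ 2 + (1 / (m : ℝ)) * ‖sndL m n z‖ ^ 2 := by
    intro j hj
    have hm : (0 : ℝ) < m := by
      have := Finset.mem_range.1 hj
      exact_mod_cast (Nat.zero_le j).trans_lt this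
    have hA : 0 ≤ ∑ i, cX z j i ^ 2 := Finset.sum_nonneg fun i _ => sq_nonneg _
    have hB : 0 ≤ (1 / (m : ℝ)) * ‖sndL m n z‖ ^ 2 := by positivity
    refine (Real.le_sqrt (norm_nonneg _) (by positivity)).1 ?_
    rw [lam_apply, Prod.norm_def]
    refine max_le ((pi_norm_le_iff_of_nonneg (Real.sqrt_nonneg _)).2 fun i => ?_)
      ((pi_norm_le_iff_of_nonneg (Real.sqrt_nonneg _)).2 fun i => ?_)
    · refine Real.le_sqrt_of_sq_le ?_
      rw [Real.norm_eq_abs, sq_abs]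
      have := Finset.single_le_sum (f := fun i => cX z j i ^ 2) (fun i _ => sq_nonneg _)
        (Finset.mem_univ i)
      linarith
    · refine Real.le_sqrt_of_sq_le ?_
      rw [Real.norm_eq_abs, sq_abs]
      have h1 : (∑ k ∈ Finset.range j, cY z k i) ^ 2 ≤ m * ‖sndL m n z‖ ^ 2 := by
        refine (sq_sum_le_card_mul_sum_sq).trans ?_
        rw [Finset.card_range]
        have hjm : (j : ℝ) ≤ m := by exact_mod_cast (Finset.mem_range.1 hj).le
        have h2 : ∑ k ∈ Finset.range j, cY z k i ^ 2 ≤ ‖sndL m n z‖ ^ 2 := by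
          rw [hY]
          refine (Finset.sum_le_sum_of_subset_of_nonneg (Finset.range_mono
            (Finset.mem_range.1 hj).le) fun k _ _ => sq_nonneg _).trans ?_
          exact Finset.sum_le_sum fun k _ => Finset.single_le_sum
            (f := fun i => cY z k i ^ 2) (fun i _ => sq_nonneg _) (Finset.mem_univ i)
        exact mul_le_mul hjm h2 (Finset.sum_nonneg fun i _ => sq_nonneg _) hm.le
      have h3 : (1 / (m : ℝ) * ∑ k ∈ Finset.range j, cY z k i) ^ 2 ≤
          1 / (m : ℝ) * ‖sndL m n z‖ ^ 2 := by
        rw [mul_pow]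
        calc _ ≤ (1 / (m : ℝ)) ^ 2 * (m * ‖sndL m n z‖ ^ 2) := by gcongr
          _ = _ := by field_simp
      linarith
  refine (Finset.sum_le_sum key).trans ?_
  rw [Finset.sum_add_distrib, Finset.sum_const, Finset.card_range, norm_sq_EE, hX, nsmul_eq_mul]
  rcases Nat.eq_zero_or_pos m with rfl | hm
  · simp
  · have : (m : ℝ) ≠ 0 := by positivity
    refine le_of_eq ?_
    field_simp

lemma norm_phase_le {n : ℕ} {v : Phase n} {r : ℝ} (hr : 0 ≤ r) (h1 : ∀ i, |v.1 i| ≤ r)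
    (h2 : ∀ i, |v.2 i| ≤ r) : ‖v‖ ≤ r :=
  max_le ((pi_norm_le_iff_of_nonneg hr).2 h1) ((pi_norm_le_iff_of_nonneg hr).2 h2)

/-- Nearly critical discrete paths are approximate Hamiltonian trajectories. -/
lemma crit_seq {n : ℕ} {φ : Phase n → ℝ} {C : ℝ} (hφ : Nice φ C) {m : ℕ} (hm : 0 < m)
    (x0 : Phase n) (x y a b : ℕ → Fin n → ℝ) {κ B : ℝ} (hκ : 0 ≤ κ) (hB : 0 ≤ B)
    (ha : ∀ j < m, ∀ i, |a j i| ≤ B) (hb : ∀ j < m, ∀ i, |b j i| ≤ B)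
    (hy : ∀ k < m, ∀ i, |y k i + a k i| ≤ κ)
    (hx : ∀ k < m, ∀ i, |x k i + (1 / (m : ℝ)) * ∑ j ∈ Finset.Ico (k + 1) m, b j i| ≤ κ)
    (Z : ℕ → Phase n)
    (hZ : ∀ j < m, Z j = x0 + (x j, fun i => (1 / (m : ℝ)) * ∑ k ∈ Finset.range j, y k i))
    {i k : ℕ} (hik : i ≤ k) (hk : k < m) :
    φ (Z i) - φ (Z k) ≤ -((1 / (m : ℝ)) * ∑ j ∈ Finset.Ico i k, fderiv ℝ φ (Z j) (b j, -a j))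
      + C * (κ + 2 * B / m) * (B + 2) := by
  have hm' : (0 : ℝ) < m := by exact_mod_cast hm
  have hC : 0 ≤ C := hφ.2.1
  set W : ℕ → Phase n := fun j => x0 + (fun i => -((1 / (m : ℝ)) * ∑ l ∈ Finset.Ico j m, b l i),
    fun i => -((1 / (m : ℝ)) * ∑ l ∈ Finset.range j, a l i)) with hW
  have hWs : ∀ j < m, W (j + 1) - W j = (1 / (m : ℝ)) • (b j, -a j) := by
    intro j hj
    ext i
    · simp only [hW, Prod.fst_sub, Prod.fst_add, Pi.sub_apply, Pi.add_apply, Prod.smul_fst,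
        Pi.smul_apply, smul_eq_mul]
      rw [Finset.sum_eq_sum_Ico_succ_bot hj]
      ring
    · simp only [hW, Prod.snd_sub, Prod.snd_add, Pi.sub_apply, Pi.add_apply, Prod.smul_snd,
        Pi.smul_apply, smul_eq_mul, Pi.neg_apply]
      rw [Finset.sum_range_succ]
      ring
  have hWn : ∀ j < m, ‖W (j + 1) - W j‖ ≤ B / m := by
    intro j hj
    rw [hWs j hj, norm_smul, Real.norm_of_nonneg (by positivity), one_div, inv_mul_eq_div]
    gcongr
    refine norm_phase_le hB (hb j hj) fun i => ?_
    simpa using ha j hj i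
  have hZW : ∀ j < m, ‖Z j - W j‖ ≤ κ + B / m := by
    intro j hj
    have hBm : 0 ≤ B / m := by positivity
    refine norm_phase_le (by positivity) (fun i => ?_) fun i => ?_
    · rw [hZ j hj]
      simp only [hW, Prod.fst_sub, Prod.fst_add, Pi.sub_apply, Pi.add_apply]
      have e : x0.1 i + x j i - (x0.1 i + -((1 / (m : ℝ)) * ∑ l ∈ Finset.Ico j m, b l i)) =
          (x j i + (1 / (m : ℝ)) * ∑ l ∈ Finset.Ico (j + 1) m, b l i) + b j i / m := by
        rw [Finset.sum_eq_sum_Ico_succ_bot hj]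
        ring
      rw [e]
      refine (abs_add_le _ _).trans (add_le_add (hx j hj i) ?_)
      rw [abs_div, abs_of_pos hm']
      have := hb j hj i
      gcongr
    · rw [hZ j hj]
      simp only [hW, Prod.snd_sub, Prod.snd_add, Pi.sub_apply, Pi.add_apply]
      have e : x0.2 i + (1 / (m : ℝ)) * ∑ l ∈ Finset.range j, y l i -
          (x0.2 i + -((1 / (m : ℝ)) * ∑ l ∈ Finset.range j, a l i)) =
          (1 / (m : ℝ)) * ∑ l ∈ Finset.range j, (y l i + a l i) := by
        rw [Finset.sum_add_distrib]
        ring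
      rw [e, abs_mul, abs_of_pos (by positivity : 0 < 1 / (m : ℝ))]
      have h1 : |∑ l ∈ Finset.range j, (y l i + a l i)| ≤ m * κ := by
        refine (Finset.abs_sum_le_sum_abs _ _).trans ?_
        refine (Finset.sum_le_card_nsmul _ _ κ fun l hl =>
          hy l ((Finset.mem_range.1 hl).trans hj) i).trans ?_
        rw [Finset.card_range, nsmul_eq_mul]
        have : (j : ℝ) ≤ m := by exact_mod_cast hj.le
        gcongr
      calc _ ≤ 1 / (m : ℝ) * (m * κ) := by gcongr
        _ = κ := by field_simp
        _ ≤ _ := by linarith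
  have hstep : ∀ j < m, (1 / (m : ℝ)) * fderiv ℝ φ (Z j) (b j, -a j) -
      C * (κ + 2 * B / m) * (B / m) ≤ φ (W (j + 1)) - φ (W j) := by
    intro j hj
    have hBm : 0 ≤ B / m := by positivity
    have h1 := hZW j hj
    have h2 := hWn j hj
    have h3 : ‖W (j + 1) - Z j‖ ≤ κ + 2 * B / m := by
      have : W (j + 1) - Z j = (W (j + 1) - W j) - (Z j - W j) := by abel
      rw [this]
      refine (norm_sub_le _ _).trans ?_
      have : 2 * B / m = B / m + B / m := by ring
      linarith
    have h4 : ‖W j - Z j‖ ≤ κ + 2 * B / m := by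
      rw [norm_sub_rev]
      have : 2 * B / m = B / m + B / m := by ring
      linarith
    have h5 := hφ.taylor h4 h3
    rw [hWs j hj, map_smul, smul_eq_mul, ← hWs j hj] at h5
    have h6 : C * (κ + 2 * B / m) * ‖W (j + 1) - W j‖ ≤ C * (κ + 2 * B / m) * (B / m) := by
      gcongr
    have := neg_le_of_abs_le h5
    linarith
  have hsum : ∑ j ∈ Finset.Ico i k, ((1 / (m : ℝ)) * fderiv ℝ φ (Z j) (b j, -a j) -
      C * (κ + 2 * B / m) * (B / m)) ≤ φ (W k) - φ (W i) := by
    rw [← Finset.sum_Ico_sub (fun j => φ (W j)) hik]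
    exact Finset.sum_le_sum fun j hj => hstep j ((Finset.mem_Ico.1 hj).2.trans hk)
  rw [Finset.sum_sub_distrib, Finset.sum_const, ← Finset.mul_sum, Nat.card_Ico,
    nsmul_eq_mul] at hsum
  have hcard : ((k - i : ℕ) : ℝ) * (C * (κ + 2 * B / m) * (B / m)) ≤ C * (κ + 2 * B / m) * B := by
    have : ((k - i : ℕ) : ℝ) ≤ m := by exact_mod_cast (Nat.sub_le k i).trans hk.le
    calc _ ≤ (m : ℝ) * (C * (κ + 2 * B / m) * (B / m)) := by gcongr
      _ = _ := by field_simp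
  have hl : ∀ j < m, |φ (Z j) - φ (W j)| ≤ C * (κ + 2 * B / m) := by
    intro j hj
    refine (hφ.lip _ _).trans ?_
    have h1 := hZW j hj
    have : 2 * B / m = B / m + B / m := by ring
    have hBm : 0 ≤ B / m := by positivity
    gcongr
    linarith
  have h1 := abs_le.1 (hl i (hik.trans_lt hk))
  have h2 := abs_le.1 (hl k hk)
  have e : C * (κ + 2 * B / m) * (B + 2) = C * (κ + 2 * B / m) * B + C * (κ + 2 * B / m) +
    C * (κ + 2 * B / m) := by ring
  rw [e]
  linarith [h1.1, h1.2, h2.1, h2.2]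

/-- Signs of the first Hamiltonian. -/
noncomputable def al (N j : ℕ) : ℝ := if j < N then 1 else if 2 * N ≤ j ∧ j < 3 * N then -1 else 0

/-- Signs of the second Hamiltonian. -/
noncomputable def be (N j : ℕ) : ℝ :=
  if N ≤ j ∧ j < 2 * N then 1 else if 3 * N ≤ j ∧ j < 4 * N then -1 else 0

lemma sum_four (N : ℕ) (f : ℕ → ℝ) : ∑ j ∈ Finset.range (4 * N), f j =
    ∑ k ∈ Finset.range N, (f k + f (N + k) + f (2 * N + k) + f (3 * N + k)) := by
  have e : 4 * N = N + N + N + N := by ring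
  rw [e, Finset.sum_range_add, Finset.sum_range_add, Finset.sum_range_add]
  simp only [Finset.sum_add_distrib]
  congr 4 <;> (funext k; congr 1; ring)

lemma al_vals {N k : ℕ} (hk : k < N) : al N k = 1 ∧ al N (N + k) = 0 ∧ al N (2 * N + k) = -1 ∧
    al N (3 * N + k) = 0 := by
  refine ⟨?_, ?_, ?_, ?_⟩ <;> simp only [al] <;> split_ifs <;> first | rfl | omega

lemma be_vals {N k : ℕ} (hk : k < N) : be N k = 0 ∧ be N (N + k) = 1 ∧ be N (2 * N + k) = 0 ∧
    be N (3 * N + k) = -1 := by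
  refine ⟨?_, ?_, ?_, ?_⟩ <;> simp only [be] <;> split_ifs <;> first | rfl | omega

lemma al_abs (N j : ℕ) : |al N j| ≤ 1 := by
  rw [al]; split_ifs <;> simp

lemma be_abs (N j : ℕ) : |be N j| ≤ 1 := by
  rw [be]; split_ifs <;> simp

lemma sum_al (N : ℕ) (f : ℕ → ℝ) : ∑ j ∈ Finset.range (4 * N), al N j * f j =
    ∑ k ∈ Finset.range N, (f k - f (2 * N + k)) := by
  rw [sum_four]
  refine Finset.sum_congr rfl fun k hk => ?_
  obtain ⟨h1, h2, h3, h4⟩ := al_vals (Finset.mem_range.1 hk)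
  rw [h1, h2, h3, h4]; ring

lemma sum_be (N : ℕ) (f : ℕ → ℝ) : ∑ j ∈ Finset.range (4 * N), be N j * f j =
    ∑ k ∈ Finset.range N, (f (N + k) - f (3 * N + k)) := by
  rw [sum_four]
  refine Finset.sum_congr rfl fun k hk => ?_
  obtain ⟨h1, h2, h3, h4⟩ := be_vals (Finset.mem_range.1 hk)
  rw [h1, h2, h3, h4]; ring

lemma sum_lt_pairs (N : ℕ) : ∑ k ∈ Finset.range N, ∑ l ∈ Finset.range N,
    (2 * (if k < l then (1 : ℝ) else 0) - 1) = -(N : ℝ) := by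
  have h : ∑ k ∈ Finset.range N, ∑ l ∈ Finset.range N,
    (2 * (if k < l then (1 : ℝ) else 0) - 1) = ∑ k ∈ Finset.range N, ∑ l ∈ Finset.range N,
    (2 * (if l < k then (1 : ℝ) else 0) - 1) := Finset.sum_comm
  have h2 : ∑ k ∈ Finset.range N, ∑ l ∈ Finset.range N,
    (2 * (if k < l then (1 : ℝ) else 0) - 1) + ∑ k ∈ Finset.range N, ∑ l ∈ Finset.range N,
    (2 * (if l < k then (1 : ℝ) else 0) - 1) =
    ∑ k ∈ Finset.range N, ∑ l ∈ Finset.range N, -2 * (if k = l then (1:ℝ) else 0) := by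
    rw [← Finset.sum_add_distrib]
    refine Finset.sum_congr rfl fun k _ => ?_
    rw [← Finset.sum_add_distrib]
    refine Finset.sum_congr rfl fun l _ => ?_
    rcases lt_trichotomy k l with h | h | h
    · simp [h, h.not_gt, h.ne]; norm_num
    · simp [h]; norm_num
    · simp [h, h.not_gt, h.ne']; norm_num
  have h3 : ∑ k ∈ Finset.range N, ∑ l ∈ Finset.range N, -2 * (if k = l then (1:ℝ) else 0) =
      -2 * N := by
    rw [Finset.sum_congr rfl (g := fun _ => (-2 : ℝ))]
    · simp [mul_comm]
    · intro k hk
      rw [← Finset.mul_sum, Finset.sum_ite_eq, if_pos hk, mul_one]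
  linarith

/-- Indicator of `k < j`. -/
noncomputable def lt01 (k j : ℕ) : ℝ := if k < j then 1 else 0

lemma sum_alal (N : ℕ) : ∑ k ∈ Finset.range (4 * N), al N k *
    ∑ j ∈ Finset.range (4 * N), al N j * lt01 k j = -(N : ℝ) := by
  simp only [sum_al]
  rw [← sum_lt_pairs]
  refine Finset.sum_congr rfl fun k hk => ?_
  rw [← Finset.sum_sub_distrib]
  refine Finset.sum_congr rfl fun l hl => ?_
  rw [Finset.mem_range] at hk hl
  simp only [lt01]
  split_ifs <;> first | omega | norm_num

lemma sum_bebe (N : ℕ) : ∑ k ∈ Finset.range (4 * N), be N k *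
    ∑ j ∈ Finset.range (4 * N), be N j * lt01 k j = -(N : ℝ) := by
  simp only [sum_be]
  rw [← sum_lt_pairs]
  refine Finset.sum_congr rfl fun k hk => ?_
  rw [← Finset.sum_sub_distrib]
  refine Finset.sum_congr rfl fun l hl => ?_
  rw [Finset.mem_range] at hk hl
  simp only [lt01]
  split_ifs <;> first | omega | norm_num

lemma sum_albe (N : ℕ) : ∑ k ∈ Finset.range (4 * N), al N k *
    ∑ j ∈ Finset.range (4 * N), be N j * lt01 k j = (N : ℝ) ^ 2 := by
  simp only [sum_be, sum_al]
  have : (N : ℝ) ^ 2 = ∑ k ∈ Finset.range N, ∑ l ∈ Finset.range N, (1 : ℝ) := by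
    simp [pow_two]
  rw [this]
  refine Finset.sum_congr rfl fun k hk => ?_
  rw [← Finset.sum_sub_distrib]
  refine Finset.sum_congr rfl fun l hl => ?_
  rw [Finset.mem_range] at hk hl
  simp only [lt01]
  split_ifs <;> first | omega | norm_num

lemma sum_beal (N : ℕ) : ∑ k ∈ Finset.range (4 * N), be N k *
    ∑ j ∈ Finset.range (4 * N), al N j * lt01 k j = -(N : ℝ) ^ 2 := by
  simp only [sum_be, sum_al]
  have : -(N : ℝ) ^ 2 = ∑ k ∈ Finset.range N, ∑ l ∈ Finset.range N, (-1 : ℝ) := by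
    simp [pow_two]
  rw [this]
  refine Finset.sum_congr rfl fun k hk => ?_
  rw [← Finset.sum_sub_distrib]
  refine Finset.sum_congr rfl fun l hl => ?_
  rw [Finset.mem_range] at hk hl
  simp only [lt01]
  split_ifs <;> first | omega | norm_num

/-- A discretised integral of `F` along the path, with weights `c`. -/
noncomputable def act {m n : ℕ} (c : ℕ → ℝ) (F : Phase n → ℝ) (x0 : Phase n) (z : EE m n) : ℝ :=
  ∑ j ∈ Finset.range m, c j * F (x0 + lam m n j z)

lemma Nice.finset_sum {E ι : Type*} [NormedAddCommGroup E] [NormedSpace ℝ E] (s : Finset ι)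
    (φ : ι → E → ℝ) (h : ∀ i ∈ s, ∃ C, Nice (φ i) C) : ∃ C, Nice (fun z => ∑ i ∈ s, φ i z) C := by
  classical
  induction s using Finset.induction_on with
  | empty =>
    refine ⟨0, ?_⟩
    simp only [Finset.sum_empty]
    refine ⟨contDiff_const, le_rfl, by simp, by simp, by simp⟩
  | insert i s hi ih =>
    obtain ⟨C, hC⟩ := h i (Finset.mem_insert_self _ _)
    obtain ⟨D, hD⟩ := ih fun j hj => h j (Finset.mem_insert_of_mem hj)
    refine ⟨C + D, ?_⟩
    simp only [Finset.sum_insert hi]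
    exact hC.add hD

lemma act_nice {m n : ℕ} (c : ℕ → ℝ) {F : Phase n → ℝ} {C : ℝ} (hF : Nice F C) (x0 : Phase n) :
    ∃ C', Nice (fun z : EE m n => act c F x0 z) C' :=
  Nice.finset_sum _ _ fun j _ => ⟨_, (hF.comp_affine x0 (lam m n j)).const_mul (c j)⟩

lemma sum_affine_fderiv {E G : Type*} [NormedAddCommGroup E] [NormedSpace ℝ E]
    [NormedAddCommGroup G] [NormedSpace ℝ G] (m : ℕ) (l : ℕ → E →L[ℝ] G)
    (c : ℕ → ℝ) {F : G → ℝ} {C : ℝ} (hF : Nice F C) (x0 : G)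
    (z ξ : E) : fderiv ℝ (fun z : E => ∑ j ∈ Finset.range m, c j * F (x0 + l j z)) z ξ =
      ∑ j ∈ Finset.range m, c j * fderiv ℝ F (x0 + l j z) (l j ξ) := by
  have h : HasFDerivAt (fun z : E => ∑ j ∈ Finset.range m, c j * F (x0 + l j z))
      (∑ j ∈ Finset.range m, c j • (fderiv ℝ F (x0 + l j z)).comp (l j)) z := by
    refine HasFDerivAt.fun_sum fun j _ => ?_
    have e1 : HasFDerivAt (fun z => x0 + l j z) (l j) z :=
      (l j).hasFDerivAt.const_add x0
    have e2 := (hF.1.differentiable (by norm_num) (x0 + l j z)).hasFDerivAt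
    exact (e2.comp z e1).const_mul (c j)
  rw [h.fderiv]
  simp

lemma act_fderiv {m n : ℕ} (c : ℕ → ℝ) {F : Phase n → ℝ} {C : ℝ} (hF : Nice F C) (x0 : Phase n)
    (z ξ : EE m n) : fderiv ℝ (fun z : EE m n => act c F x0 z) z ξ =
      ∑ j ∈ Finset.range m, c j * fderiv ℝ F (x0 + lam m n j z) (lam m n j ξ) :=
  sum_affine_fderiv m (lam m n) c hF x0 z ξ

noncomputable def ex {m n : ℕ} (k : ℕ) (i : Fin n) : EE m n :=
  mkE (fun k' => if k' = k then Pi.single i 1 else 0) 0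

noncomputable def ey {m n : ℕ} (k : ℕ) (i : Fin n) : EE m n :=
  mkE 0 (fun k' => if k' = k then Pi.single i 1 else 0)

lemma cX_ex {m n : ℕ} {k j : ℕ} (i : Fin n) (hj : j < m) :
    (fun i' => cX (ex k i : EE m n) j i') = if j = k then Pi.single i 1 else 0 := by
  funext i'; rw [ex, cX_mk _ _ hj]

lemma cY_ex {m n : ℕ} {k j : ℕ} (i i' : Fin n) : cY (ex k i : EE m n) j i' = 0 := by
  by_cases hj : j < m
  · rw [ex, cY_mk _ _ hj]; rfl
  · rw [cY, dif_neg hj]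

lemma cX_ey {m n : ℕ} {k j : ℕ} (i i' : Fin n) : cX (ey k i : EE m n) j i' = 0 := by
  by_cases hj : j < m
  · rw [ey, cX_mk _ _ hj]; rfl
  · rw [cX, dif_neg hj]

lemma cY_ey {m n : ℕ} {k j : ℕ} (i : Fin n) (hj : j < m) :
    (fun i' => cY (ey k i : EE m n) j i') = if j = k then Pi.single i 1 else 0 := by
  funext i'; rw [ey, cY_mk _ _ hj]

lemma sum_ex {m n k : ℕ} (hk : k < m) (i : Fin n) (f : ℕ → Fin n → ℝ) :
    ∑ k' ∈ Finset.range m, ∑ i', f k' i' * cX (ex k i : EE m n) k' i' = f k i := by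
  rw [Finset.sum_eq_single k]
  · have := cX_ex (m := m) (k := k) i hk
    rw [if_pos rfl] at this
    simp only [funext_iff] at this
    simp [this, Pi.single_apply]
  · intro b hb hbk
    have := cX_ex (m := m) (k := k) i (Finset.mem_range.1 hb)
    rw [if_neg hbk] at this
    simp only [funext_iff] at this
    simp [this]
  · intro h; exact absurd (Finset.mem_range.2 hk) h

lemma sum_ey {m n k : ℕ} (hk : k < m) (i : Fin n) (f : ℕ → Fin n → ℝ) :
    ∑ k' ∈ Finset.range m, ∑ i', f k' i' * cY (ey k i : EE m n) k' i' = f k i := by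
  rw [Finset.sum_eq_single k]
  · have := cY_ey (m := m) (k := k) i hk
    rw [if_pos rfl] at this
    simp only [funext_iff] at this
    simp [this, Pi.single_apply]
  · intro b hb hbk
    have := cY_ey (m := m) (k := k) i (Finset.mem_range.1 hb)
    rw [if_neg hbk] at this
    simp only [funext_iff] at this
    simp [this]
  · intro h; exact absurd (Finset.mem_range.2 hk) h

lemma norm_ex {m n k : ℕ} (hk : k < m) (i : Fin n) : ‖(ex k i : EE m n)‖ = 1 := by
  have : ‖(ex k i : EE m n)‖ ^ 2 = 1 := by
    rw [← real_inner_self_eq_norm_sq, inner_EE, inner_XX, inner_YY, sum_ex hk]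
    simp only [cY_ex]
    have := congrFun (cX_ex (m := m) (k := k) i hk) i
    simp only [if_true, Pi.single_eq_same] at this
    simp [this]
  nlinarith [norm_nonneg (ex k i : EE m n)]

lemma norm_ey {m n k : ℕ} (hk : k < m) (i : Fin n) : ‖(ey k i : EE m n)‖ = 1 := by
  have : ‖(ey k i : EE m n)‖ ^ 2 = 1 := by
    rw [← real_inner_self_eq_norm_sq, inner_EE, inner_XX, inner_YY, sum_ey hk]
    simp only [cX_ey]
    have := congrFun (cY_ey (m := m) (k := k) i hk) i
    simp only [if_true, Pi.single_eq_same] at this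
    simp [this]
  nlinarith [norm_nonneg (ey k i : EE m n)]

lemma lam_ex {m n k j : ℕ} (hj : j < m) (i : Fin n) : lam m n j (ex k i) =
    if j = k then (Pi.single i 1, 0) else 0 := by
  rw [lam_apply]
  simp only [cX_ex i hj, cY_ex]
  split_ifs
  · simp; rfl
  · simp; rfl

lemma lam_ey {m n k j : ℕ} (hj : j < m) (i : Fin n) : lam m n j (ey k i) =
    if k < j then (1 / (m : ℝ)) • (0, Pi.single i 1) else 0 := by
  rw [lam_apply]
  simp only [cX_ey]
  have : ∀ i', ∑ k' ∈ Finset.range j, cY (ey k i : EE m n) k' i' =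
      if k < j then (Pi.single i 1 : Fin n → ℝ) i' else 0 := by
    intro i'
    have h : ∀ k' ∈ Finset.range j, cY (ey k i : EE m n) k' i' =
        if k = k' then (Pi.single i 1 : Fin n → ℝ) i' else 0 := by
      intro k' hk'
      have := congrFun (cY_ey (m := m) (k := k) i ((Finset.mem_range.1 hk').trans hj)) i'
      rw [this]
      by_cases h : k' = k
      · simp [h]
      · simp [h, Ne.symm h]
    rw [Finset.sum_congr rfl h, Finset.sum_ite_eq]
    simp
  simp only [this]
  split_ifs
  · ext i' <;> simp
  · ext i' <;> simp

lemma crit_test {m n : ℕ} (z w : EE m n) (D : ℕ → Phase n →L[ℝ] ℝ) {κ : ℝ} (hw : ‖w‖ ≤ κ)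
    (h : ∀ ξ, inner ℝ w ξ = inner ℝ (swapL m n z) ξ +
      ∑ j ∈ Finset.range m, D j (lam m n j ξ)) {k : ℕ} (hk : k < m) (i : Fin n) :
    |cY z k i + D k (Pi.single i 1, 0)| ≤ κ ∧
    |cX z k i + (1 / (m : ℝ)) * ∑ j ∈ Finset.Ico (k + 1) m, D j (0, Pi.single i 1)| ≤ κ := by
  constructor
  · have h1 := abs_real_inner_le_norm w (ex k i)
    rw [norm_ex hk, mul_one, h, inner_swap, sum_ex hk] at h1
    refine le_trans (le_of_eq ?_) (h1.trans hw)
    congr 1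
    simp only [cY_ex, mul_zero, Finset.sum_const_zero, add_zero]
    congr 1
    rw [Finset.sum_eq_single k]
    · rw [lam_ex hk, if_pos rfl]
    · intro b hb hbk
      rw [lam_ex (Finset.mem_range.1 hb), if_neg hbk, map_zero]
    · intro h; exact absurd (Finset.mem_range.2 hk) h
  · have h1 := abs_real_inner_le_norm w (ey k i)
    rw [norm_ey hk, mul_one, h, inner_swap, sum_ey hk] at h1
    refine le_trans (le_of_eq ?_) (h1.trans hw)
    congr 1
    simp only [cX_ey, mul_zero, Finset.sum_const_zero, zero_add]
    congr 1
    have e : Finset.Ico (k + 1) m = (Finset.range m).filter (fun j => k < j) := by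
      ext j; simp [Finset.mem_Ico]; omega
    rw [e, Finset.sum_filter, Finset.mul_sum]
    refine Finset.sum_congr rfl fun j hj => ?_
    rw [lam_ey (Finset.mem_range.1 hj)]
    split_ifs
    · rw [map_smul, smul_eq_mul]
    · simp

lemma clm_phase {n : ℕ} (D : Phase n →L[ℝ] ℝ) (u v : Fin n → ℝ) :
    D (u, v) = ∑ i, (D (Pi.single i 1, 0) * u i + D (0, Pi.single i 1) * v i) := by
  have h1 : D (u, v) = D (u, 0) + D (0, v) := by rw [← map_add]; simp
  have h2 : ∀ u, D (u, 0) = ∑ i, D (Pi.single i 1, 0) * u i := by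
    intro u
    have := LinearMap.pi_apply_eq_sum_univ
      ((D : Phase n →ₗ[ℝ] ℝ).comp (LinearMap.inl ℝ (Fin n → ℝ) (Fin n → ℝ))) u
    simp only [LinearMap.comp_apply, LinearMap.inl_apply, smul_eq_mul] at this
    refine Eq.trans this (Finset.sum_congr rfl fun i _ => ?_)
    rw [mul_comm]
    have e : (fun j => if i = j then (1:ℝ) else 0) = Pi.single i 1 := by
      funext j; simp [Pi.single_apply, eq_comm]
    rw [e]
    rfl
  have h3 : ∀ u, D (0, u) = ∑ i, D (0, Pi.single i 1) * u i := by
    intro u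
    have := LinearMap.pi_apply_eq_sum_univ
      ((D : Phase n →ₗ[ℝ] ℝ).comp (LinearMap.inr ℝ (Fin n → ℝ) (Fin n → ℝ))) u
    simp only [LinearMap.comp_apply, LinearMap.inr_apply, smul_eq_mul] at this
    refine Eq.trans this (Finset.sum_congr rfl fun i _ => ?_)
    rw [mul_comm]
    have e : (fun j => if i = j then (1:ℝ) else 0) = Pi.single i 1 := by
      funext j; simp [Pi.single_apply, eq_comm]
    rw [e]
    rfl
  rw [h1, h2, h3, Finset.sum_add_distrib]

lemma abs_partial_le {n : ℕ} (D : Phase n →L[ℝ] ℝ) {C : ℝ} (hD : ‖D‖ ≤ C) (i : Fin n) :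
    |D (Pi.single i 1, 0)| ≤ C ∧ |D (0, Pi.single i 1)| ≤ C := by
  have h0 : ∀ i', |(Pi.single i (1:ℝ) : Fin n → ℝ) i'| ≤ 1 := by
    intro i'; rw [Pi.single_apply]; split_ifs <;> simp
  constructor
  · refine (D.le_opNorm _).trans ?_
    have : ‖((Pi.single i 1, 0) : Phase n)‖ ≤ 1 :=
      norm_phase_le zero_le_one h0 (by simp)
    have := norm_nonneg D
    nlinarith
  · refine (D.le_opNorm _).trans ?_
    have : ‖((0, Pi.single i 1) : Phase n)‖ ≤ 1 :=
      norm_phase_le zero_le_one (by simp) h0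
    have := norm_nonneg D
    nlinarith

lemma crit_main {n N : ℕ} (hN : 0 < N) {F G : Phase n → ℝ} {C M : ℝ} (hF : Nice F C)
    (hG : Nice G C) (hM : ∀ x, poisson F G x ≤ M) (x0 : Phase n) {s t κ : ℝ} (hs0 : 0 ≤ s)
    (hs1 : s ≤ 1) (ht0 : 0 ≤ t) (ht1 : t ≤ 1) (z w : EE (4 * N) n) (hκ : 0 ≤ κ) (hw : ‖w‖ ≤ κ)
    (h : ∀ ξ, inner ℝ w ξ = inner ℝ (swapL (4 * N) n z) ξ +
      (s * fderiv ℝ (fun z : EE (4 * N) n => act (al N) F x0 z) z ξ +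
       t * fderiv ℝ (fun z : EE (4 * N) n => act (be N) G x0 z) z ξ)) :
    act (be N) G x0 z ≤ N * (s * M / 4 +
      C * (κ + 2 * (2 * C) / ((4 * N : ℕ) : ℝ)) * (2 * C + 2)) ∧
    (t = 0 → act (al N) F x0 z ≤ N * (C * (κ + 2 * (2 * C) / ((4 * N : ℕ) : ℝ)) * (2 * C + 2))) := by
  have hC : 0 ≤ C := hF.2.1
  have hm : 0 < 4 * N := by omega
  set Z : ℕ → Phase n := fun j => x0 + lam (4 * N) n j z with hZ
  set D : ℕ → Phase n →L[ℝ] ℝ := fun j => (s * al N j) • fderiv ℝ F (Z j) +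
    (t * be N j) • fderiv ℝ G (Z j) with hD
  have hDa : ∀ j v, D j v = s * al N j * fderiv ℝ F (Z j) v + t * be N j * fderiv ℝ G (Z j) v := by
    intro j v; simp [hD]
  have hDn : ∀ j, ‖D j‖ ≤ 2 * C := by
    intro j
    refine (norm_add_le _ _).trans ?_
    rw [norm_smul, norm_smul, Real.norm_eq_abs, Real.norm_eq_abs, abs_mul, abs_mul,
      abs_of_nonneg hs0, abs_of_nonneg ht0]
    have h1 : s * |al N j| * ‖fderiv ℝ F (Z j)‖ ≤ 1 * 1 * C := by
      gcongr
      · exact al_abs N j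
      · exact hF.2.2.2.1 _
    have h2 : t * |be N j| * ‖fderiv ℝ G (Z j)‖ ≤ 1 * 1 * C := by
      gcongr
      · exact be_abs N j
      · exact hG.2.2.2.1 _
    linarith
  have h' : ∀ ξ, inner ℝ w ξ = inner ℝ (swapL (4 * N) n z) ξ +
      ∑ j ∈ Finset.range (4 * N), D j (lam (4 * N) n j ξ) := by
    intro ξ
    rw [h, act_fderiv _ hF, act_fderiv _ hG, Finset.mul_sum, Finset.mul_sum,
      ← Finset.sum_add_distrib]
    congr 1
    refine Finset.sum_congr rfl fun j _ => ?_
    rw [hDa]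
    ring
  have hct := fun k (hk : k < 4 * N) i => crit_test z w D hw h' hk i
  have key : ∀ φ : Phase n → ℝ, Nice φ C → ∀ i k : ℕ, i ≤ k → k < 4 * N →
      φ (Z i) - φ (Z k) ≤ -((1 / ((4 * N : ℕ) : ℝ)) * ∑ j ∈ Finset.Ico i k,
        fderiv ℝ φ (Z j) (fun i => D j (0, Pi.single i 1), -fun i => D j (Pi.single i 1, 0)))
      + C * (κ + 2 * (2 * C) / ((4 * N : ℕ) : ℝ)) * (2 * C + 2) := by
    intro φ hφ i k hik hk
    exact crit_seq hφ hm x0 (fun j i => cX z j i) (fun j i => cY z j i)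
      (fun j i => D j (Pi.single i 1, 0)) (fun j i => D j (0, Pi.single i 1)) hκ (by positivity)
      (fun j _ i => (abs_partial_le _ (hDn j) i).1) (fun j _ i => (abs_partial_le _ (hDn j) i).2)
      (fun k hk i => (hct k hk i).1) (fun k hk i => (hct k hk i).2) Z
      (fun j _ => by rw [hZ]; simp only [lam_apply]) hik hk
  set e := C * (κ + 2 * (2 * C) / ((4 * N : ℕ) : ℝ)) * (2 * C + 2) with he
  have hN' : (0 : ℝ) < N := by exact_mod_cast hN
  have hcast : ((4 * N : ℕ) : ℝ) = 4 * N := by push_cast; ring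
  constructor
  · have hbr : ∀ j, fderiv ℝ G (Z j) (fun i => D j (0, Pi.single i 1),
        -fun i => D j (Pi.single i 1, 0)) = s * al N j * poisson F G (Z j) := by
      intro j
      rw [clm_phase, poisson, Finset.mul_sum]
      refine Finset.sum_congr rfl fun i _ => ?_
      simp only [pderivP, pderivQ, hDa, Pi.neg_apply]
      ring
    have hterm : ∀ k ∈ Finset.range N, G (Z (N + k)) - G (Z (3 * N + k)) ≤ s * M / 4 + e := by
      intro k hk
      rw [Finset.mem_range] at hk
      refine (key G hG (N + k) (3 * N + k) (by omega) (by omega)).trans ?_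
      simp only [hbr]
      have h1 : -∑ j ∈ Finset.Ico (N + k) (3 * N + k), s * al N j * poisson F G (Z j) =
          ∑ j ∈ Finset.Ico (2 * N) (3 * N), s * poisson F G (Z j) := by
        rw [← Finset.sum_neg_distrib]
        symm
        refine Finset.sum_subset_zero_on_sdiff ?_ ?_ ?_
        · intro j hj
          rw [Finset.mem_Ico] at *
          omega
        · intro j hj
          simp only [Finset.mem_sdiff, Finset.mem_Ico] at hj
          have : al N j = 0 := by
            rw [al, if_neg (by omega), if_neg (by omega)]
          rw [this]; ring
        · intro j hj
          rw [Finset.mem_Ico] at hj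
          have : al N j = -1 := by
            rw [al, if_neg (by omega), if_pos (by omega)]
          rw [this]; ring
      have h2 : ∑ j ∈ Finset.Ico (2 * N) (3 * N), s * poisson F G (Z j) ≤ N * (s * M) := by
        refine (Finset.sum_le_card_nsmul _ _ (s * M) fun j _ =>
          mul_le_mul_of_nonneg_left (hM _) hs0).trans ?_
        rw [Nat.card_Ico, nsmul_eq_mul]
        have : 3 * N - 2 * N = N := by omega
        rw [this]
      have h3 : -(1 / ((4 * N : ℕ) : ℝ) * ∑ j ∈ Finset.Ico (N + k) (3 * N + k),
          s * al N j * poisson F G (Z j)) ≤ s * M / 4 := by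
        rw [← mul_neg, h1, hcast]
        calc _ ≤ 1 / (4 * (N : ℝ)) * (N * (s * M)) := by gcongr
          _ = _ := by field_simp
      linarith
    rw [act, sum_be N (fun j => G (x0 + lam (4 * N) n j z))]
    refine (Finset.sum_le_card_nsmul _ _ _ hterm).trans ?_
    rw [Finset.card_range, nsmul_eq_mul]
  · intro ht
    have hbr : ∀ j, fderiv ℝ F (Z j) (fun i => D j (0, Pi.single i 1),
        -fun i => D j (Pi.single i 1, 0)) = 0 := by
      intro j
      rw [clm_phase]
      refine Finset.sum_eq_zero fun i _ => ?_
      simp only [hDa, Pi.neg_apply, ht]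
      ring
    have hterm : ∀ k ∈ Finset.range N, F (Z k) - F (Z (2 * N + k)) ≤ e := by
      intro k hk
      rw [Finset.mem_range] at hk
      refine (key F hF k (2 * N + k) (by omega) (by omega)).trans ?_
      simp only [hbr]
      simp
    rw [act, sum_al N (fun j => F (x0 + lam (4 * N) n j z))]
    refine (Finset.sum_le_card_nsmul _ _ _ hterm).trans ?_
    rw [Finset.card_range, nsmul_eq_mul]

/-- Upper bound for the minimax value. -/
lemma upper_bound {n N : ℕ} (hN : 0 < N) {F G : Phase n → ℝ} {C M : ℝ} (hF : Nice F C)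
    (hG : Nice G C) (hM : ∀ x, poisson F G x ≤ M) (x0 : Phase n) {s κ a : ℝ} (hs0 : 0 ≤ s)
    (hs1 : s ≤ 1) (hκ : 0 < κ) {e : ℝ}
    (he : C * (κ + 2 * (2 * C) / ((4 * N : ℕ) : ℝ)) * (2 * C + 2) < e)
    (h : Linked (sumL (4 * N) n) (fun z => QQ z + s * act (al N) F x0 z +
      s * act (be N) G x0 z) a) :
    a ≤ N * (s ^ 2 * M / 4 + 2 * s * e) := by
  have hN' : (0 : ℝ) < N := by exact_mod_cast hN
  obtain ⟨CA, hA⟩ := act_nice (m := 4 * N) (al N) hF x0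
  obtain ⟨CB, hB⟩ := act_nice (m := 4 * N) (be N) hG x0
  obtain ⟨A1, A2, A3, A4⟩ := hA.gradient_facts
  obtain ⟨B1, B2, B3, B4⟩ := hB.gradient_facts
  set 𝓕 : EE (4 * N) n → ℝ := fun z => act (al N) F x0 z with h𝓕
  set 𝓖 : EE (4 * N) n → ℝ := fun z => act (be N) G x0 z with h𝓖
  have hA0 : 0 ≤ CA := hA.2.1
  have hB0 : 0 ≤ CB := hB.2.1
  have hinner : ∀ p q : ℝ, ∀ z ξ, inner ℝ (swapL (4 * N) n z + (p • gradient 𝓕 z +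
      q • gradient 𝓖 z)) ξ = inner ℝ (swapL (4 * N) n z) ξ +
      (p * inner ℝ (gradient 𝓕 z) ξ + q * inner ℝ (gradient 𝓖 z) ξ) := by
    intro p q z ξ
    rw [inner_add_left, inner_add_left, real_inner_smul_left, real_inner_smul_left]
  have hascG : ∀ p ∈ Set.Icc (0:ℝ) 1, ∀ q ∈ Set.Icc (0:ℝ) 1, ∀ z ξ,
      QQ z + p * 𝓕 z + q * 𝓖 z + inner ℝ (swapL (4 * N) n z + (p • gradient 𝓕 z +
      q • gradient 𝓖 z)) ξ - (1 + CA + CB) * ‖ξ‖ ^ 2 ≤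
      QQ (z + ξ) + p * 𝓕 (z + ξ) + q * 𝓖 (z + ξ) := by
    rintro p ⟨hp0, hp1⟩ q ⟨hq0, hq1⟩ z ξ
    rw [hinner, QQ_add]
    have h1 := (abs_le.1 (A4 z ξ)).1
    have h2 := (abs_le.1 (B4 z ξ)).1
    have h3 := QQ_ge ξ
    have h4 : 0 ≤ ‖ξ‖ ^ 2 := by positivity
    have h5 : p * (-(CA * ‖ξ‖ ^ 2)) ≤ p * (𝓕 (z + ξ) - 𝓕 z - inner ℝ (gradient 𝓕 z) ξ) :=
      mul_le_mul_of_nonneg_left h1 hp0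
    have h6 : q * (-(CB * ‖ξ‖ ^ 2)) ≤ q * (𝓖 (z + ξ) - 𝓖 z - inner ℝ (gradient 𝓖 z) ξ) :=
      mul_le_mul_of_nonneg_left h2 hq0
    have h7 : p * (CA * ‖ξ‖ ^ 2) ≤ CA * ‖ξ‖ ^ 2 := mul_le_of_le_one_left (by positivity) hp1
    have h8 : q * (CB * ‖ξ‖ ^ 2) ≤ CB * ‖ξ‖ ^ 2 := mul_le_of_le_one_left (by positivity) hq1
    linarith
  have hcrit : ∀ p ∈ Set.Icc (0:ℝ) 1, ∀ q ∈ Set.Icc (0:ℝ) 1, ∀ z,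
      ‖swapL (4 * N) n z + (p • gradient 𝓕 z + q • gradient 𝓖 z)‖ < κ → _ :=
    fun p hp q hq z hz => crit_main hN hF hG hM x0 hp.1 hp.2 hq.1 hq.2 z
      (swapL (4 * N) n z + (p • gradient 𝓕 z + q • gradient 𝓖 z)) hκ.le hz.le
      (fun ξ => by rw [hinner, A3, B3])
  set e' := C * (κ + 2 * (2 * C) / ((4 * N : ℕ) : ℝ)) * (2 * C + 2) with he'
  have step1 : Linked (sumL (4 * N) n) (fun z => QQ z + s * 𝓕 z) (a - s * (N * (s * M / 4 + e))) := by
    refine Linked.descend (L := swapL (4 * N) n) sum_swap (g := 𝓖)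
      (β := fun z => s • gradient 𝓕 z) (γ := gradient 𝓖)
      (A1.const_smul s) B1 (Cβ := s * CA) (Cγ := CB) (fun z => ?_) B2
      (Kc := 1 + CA + CB) hs0 ?_ (C0 := CB) (Lg := CB) (κ := κ) (μ := N * (s * M / 4 + e'))
      hB.2.2.1 (fun z z' => hB.lip z' z) hB0 hκ ?_ ?_ h
    · rw [norm_smul, Real.norm_of_nonneg hs0]
      exact mul_le_mul_of_nonneg_left (A2 z) hs0
    · intro t ht z ξ
      exact hascG s ⟨hs0, hs1⟩ t ⟨ht.1, ht.2.trans hs1⟩ z ξ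
    · intro t ht z hz
      exact (hcrit s ⟨hs0, hs1⟩ t ⟨ht.1, ht.2.trans hs1⟩ z hz).1
    · gcongr
  have step2 : Linked (sumL (4 * N) n) QQ (a - s * (N * (s * M / 4 + e)) - s * (N * e)) := by
    refine Linked.descend (L := swapL (4 * N) n) sum_swap (g := 𝓕)
      (β := fun z => 0) (γ := gradient 𝓕)
      contDiff_const A1 (Cβ := 0) (Cγ := CA) (fun z => by simp) A2
      (Kc := 1 + CA + CB) hs0 ?_ (C0 := CA) (Lg := CA) (κ := κ) (μ := N * e')
      hA.2.2.1 (fun z z' => hA.lip z' z) hA0 hκ ?_ ?_ step1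
    · intro t ht z ξ
      have := hascG t ⟨ht.1, ht.2.trans hs1⟩ 0 ⟨le_rfl, zero_le_one⟩ z ξ
      simp only [zero_mul, zero_smul, add_zero] at this
      simp only [zero_add]
      exact this
    · intro t ht z hz
      refine (hcrit t ⟨ht.1, ht.2.trans hs1⟩ 0 ⟨le_rfl, zero_le_one⟩ z ?_).2 rfl
      simpa using hz
    · gcongr
  have := step2.nonpos QQ_nonpos
  nlinarith

noncomputable def diagL (m n : ℕ) : VV m n →L[ℝ] EE m n :=
  (WithLp.prodContinuousLinearEquiv 2 ℝ (VV m n) (VV m n)).symm.toContinuousLinearMap.comp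
    ((ContinuousLinearMap.id ℝ (VV m n)).prod (ContinuousLinearMap.id ℝ (VV m n)))

lemma fst_diag {m n : ℕ} (v : VV m n) : fstL m n (diagL m n v) = v := rfl
lemma snd_diag {m n : ℕ} (v : VV m n) : sndL m n (diagL m n v) = v := rfl

lemma act_taylor {m n : ℕ} {c : ℕ → ℝ} (hc : ∀ j, |c j| ≤ 1) {F : Phase n → ℝ} {C : ℝ}
    (hF : Nice F C) (x0 : Phase n) (z : EE m n) :
    (∑ j ∈ Finset.range m, c j * F x0) + (∑ j ∈ Finset.range m, c j * fderiv ℝ F x0 (lam m n j z))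
      - C * ∑ j ∈ Finset.range m, ‖lam m n j z‖ ^ 2 ≤ act c F x0 z := by
  rw [act, Finset.mul_sum, ← Finset.sum_add_distrib, ← Finset.sum_sub_distrib]
  refine Finset.sum_le_sum fun j _ => ?_
  set l := lam m n j z
  have h := hF.taylor (x := x0) (y := x0 + l) (w := x0) (r := ‖l‖) (by simp) (by simp)
  rw [add_sub_cancel_left] at h
  have h2 : |c j * (F (x0 + l) - F x0 - fderiv ℝ F x0 l)| ≤ 1 * (C * ‖l‖ * ‖l‖) := by
    rw [abs_mul]
    exact mul_le_mul (hc j) h (abs_nonneg _) zero_le_one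
  have h3 := (abs_le.1 h2).1
  nlinarith

lemma lower_bound {n N : ℕ} (hN : 0 < N) {F G : Phase n → ℝ} {C : ℝ} (hF : Nice F C)
    (hG : Nice G C) (x0 : Phase n) {s : ℝ} (hs0 : 0 ≤ s) (hs1 : 8 * s * C ≤ 1) :
    Linked (sumL (4 * N) n) (fun z => QQ z + s * act (al N) F x0 z +
      s * act (be N) G x0 z)
      (N * (s ^ 2 / 4 * poisson F G x0 - 64 * s ^ 3 * C ^ 3) - s ^ 2 * n * C ^ 2 / 2) := by
  have hC : 0 ≤ C := hF.2.1
  have hN' : (0 : ℝ) < N := by exact_mod_cast hN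
  have hcast : ((4 * N : ℕ) : ℝ) = 4 * N := by push_cast; ring
  set m := 4 * N with hm
  have hm0 : (0 : ℝ) < (m : ℝ) := by rw [hcast]; positivity
  set d : ℕ → Phase n →L[ℝ] ℝ := fun j => al N j • fderiv ℝ F x0 + be N j • fderiv ℝ G x0 with hd
  have hda : ∀ j v, d j v = al N j * fderiv ℝ F x0 v + be N j * fderiv ℝ G x0 v := by
    intro j v; simp [hd]
  have hdn : ∀ j, ‖d j‖ ≤ 2 * C := by
    intro j
    refine (norm_add_le _ _).trans ?_
    rw [norm_smul, norm_smul, Real.norm_eq_abs, Real.norm_eq_abs]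
    have h1 : |al N j| * ‖fderiv ℝ F x0‖ ≤ 1 * C := by
      gcongr
      · exact al_abs N j
      · exact hF.2.2.2.1 _
    have h2 : |be N j| * ‖fderiv ℝ G x0‖ ≤ 1 * C := by
      gcongr
      · exact be_abs N j
      · exact hG.2.2.2.1 _
    linarith
  set xx : ℕ → Fin n → ℝ := fun k i => -((s / m) * ∑ j ∈ Finset.range m,
    lt01 k j * d j (0, Pi.single i 1)) with hxx
  set yy : ℕ → Fin n → ℝ := fun k i => -(s * d k (Pi.single i 1, 0)) with hyy
  set z0 : EE m n := mkE xx yy with hz0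
  have hlin : ∀ ξ : EE m n, inner ℝ (swapL m n z0) ξ =
      -(s * ∑ j ∈ Finset.range m, d j (lam m n j ξ)) := by
    intro ξ
    have h1 : ∑ k ∈ Finset.range m, ∑ i, cY z0 k i * cX ξ k i =
        ∑ k ∈ Finset.range m, ∑ i, yy k i * cX ξ k i :=
      Finset.sum_congr rfl fun k hk => Finset.sum_congr rfl fun i _ => by
        rw [hz0, cY_mk _ _ (Finset.mem_range.1 hk)]
    have h2 : ∑ k ∈ Finset.range m, ∑ i, cX z0 k i * cY ξ k i =
        ∑ k ∈ Finset.range m, ∑ i, xx k i * cY ξ k i :=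
      Finset.sum_congr rfl fun k hk => Finset.sum_congr rfl fun i _ => by
        rw [hz0, cX_mk _ _ (Finset.mem_range.1 hk)]
    have h3 : ∑ k ∈ Finset.range m, ∑ i, xx k i * cY ξ k i =
        ∑ j ∈ Finset.range m, ∑ i, -(s * (d j (0, Pi.single i 1) *
          ((1 / (m : ℝ)) * ∑ k ∈ Finset.range j, cY ξ k i))) := by
      rw [Finset.sum_comm]
      conv_rhs => rw [Finset.sum_comm]
      refine Finset.sum_congr rfl fun i _ => ?_
      have h4 : ∀ j ∈ Finset.range m, ∑ k ∈ Finset.range j, cY ξ k i =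
          ∑ k ∈ Finset.range m, lt01 k j * cY ξ k i := by
        intro j hj
        have e : Finset.range j = (Finset.range m).filter (fun k => k < j) := by
          ext k
          rw [Finset.mem_range] at hj
          simp only [Finset.mem_range, Finset.mem_filter]
          omega
        rw [e, Finset.sum_filter]
        refine Finset.sum_congr rfl fun k _ => ?_
        rw [lt01]; split_ifs <;> ring
      have h5 : ∑ j ∈ Finset.range m, -(s * (d j (0, Pi.single i 1) *
          ((1 / (m : ℝ)) * ∑ k ∈ Finset.range j, cY ξ k i))) =
          ∑ j ∈ Finset.range m, ∑ k ∈ Finset.range m, -((s / m) *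
            (lt01 k j * d j (0, Pi.single i 1))) * cY ξ k i := by
        refine Finset.sum_congr rfl fun j hj => ?_
        rw [h4 j hj, Finset.mul_sum, Finset.mul_sum, Finset.mul_sum, ← Finset.sum_neg_distrib]
        refine Finset.sum_congr rfl fun k _ => ?_
        ring
      rw [h5, Finset.sum_comm]
      refine Finset.sum_congr rfl fun k _ => ?_
      simp only [hxx]
      rw [← Finset.sum_mul, Finset.sum_neg_distrib, Finset.mul_sum]
    rw [inner_swap, h1, h2, h3, ← Finset.sum_add_distrib, Finset.mul_sum,
      ← Finset.sum_neg_distrib]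
    refine Finset.sum_congr rfl fun j _ => ?_
    rw [lam_apply, clm_phase, ← Finset.sum_add_distrib, Finset.mul_sum, ← Finset.sum_neg_distrib]
    refine Finset.sum_congr rfl fun i _ => ?_
    rw [hyy]
    ring
  have hQ : -QQ z0 = N * (s ^ 2 / 4 * poisson F G x0) + s ^ 2 / 4 * ∑ i : Fin n,
      (pderivP F i x0 * pderivQ F i x0 + pderivP G i x0 * pderivQ G i x0) := by
    have h1 : QQ z0 = ∑ k ∈ Finset.range m, ∑ i, xx k i * yy k i := by
      rw [QQ, inner_XY]
      exact Finset.sum_congr rfl fun k hk => Finset.sum_congr rfl fun i _ => by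
        rw [hz0, cY_mk _ _ (Finset.mem_range.1 hk), cX_mk _ _ (Finset.mem_range.1 hk)]
    rw [h1, Finset.sum_comm, poisson, Finset.mul_sum, Finset.mul_sum, Finset.mul_sum,
      ← Finset.sum_add_distrib, ← Finset.sum_neg_distrib]
    refine Finset.sum_congr rfl fun i _ => ?_
    set a := pderivP F i x0 with ha
    set b := pderivQ F i x0 with hb
    set a' := pderivP G i x0 with ha'
    set b' := pderivQ G i x0 with hb'
    have h2 : ∑ k ∈ Finset.range m, xx k i * yy k i = (s ^ 2 / m) * (
        a * b * ∑ k ∈ Finset.range m, al N k * ∑ j ∈ Finset.range m, al N j * lt01 k j +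
        a * b' * ∑ k ∈ Finset.range m, al N k * ∑ j ∈ Finset.range m, be N j * lt01 k j +
        a' * b * ∑ k ∈ Finset.range m, be N k * ∑ j ∈ Finset.range m, al N j * lt01 k j +
        a' * b' * ∑ k ∈ Finset.range m, be N k * ∑ j ∈ Finset.range m, be N j * lt01 k j) := by
      rw [Finset.mul_sum, Finset.mul_sum, Finset.mul_sum, Finset.mul_sum,
        ← Finset.sum_add_distrib, ← Finset.sum_add_distrib, ← Finset.sum_add_distrib,
        Finset.mul_sum]
      refine Finset.sum_congr rfl fun k _ => ?_
      have h3 : ∑ j ∈ Finset.range m, lt01 k j * d j (0, Pi.single i 1) =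
          b * ∑ j ∈ Finset.range m, al N j * lt01 k j +
          b' * ∑ j ∈ Finset.range m, be N j * lt01 k j := by
        rw [Finset.mul_sum, Finset.mul_sum, ← Finset.sum_add_distrib]
        refine Finset.sum_congr rfl fun j _ => ?_
        rw [hda, hb, hb', pderivQ, pderivQ]
        ring
      have h4 : d k (Pi.single i 1, 0) = al N k * a + be N k * a' := by
        rw [hda, ha, ha', pderivP, pderivP]
      simp only [hxx, hyy, h3, h4]
      ring
    rw [h2, hm, sum_alal, sum_albe, sum_beal, sum_bebe, hcast]
    field_simp
    ring
  have hQ2 : N * (s ^ 2 / 4 * poisson F G x0) - s ^ 2 * n * C ^ 2 / 2 ≤ -QQ z0 := by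
    rw [hQ]
    have h1 : -(2 * n * C ^ 2) ≤ ∑ i : Fin n,
      (pderivP F i x0 * pderivQ F i x0 + pderivP G i x0 * pderivQ G i x0) := by
      have : ∑ i : Fin n, (-(2 * C ^ 2)) ≤ ∑ i : Fin n,
        (pderivP F i x0 * pderivQ F i x0 + pderivP G i x0 * pderivQ G i x0) := by
        refine Finset.sum_le_sum fun i _ => ?_
        have h3 := abs_partial_le _ (hF.2.2.2.1 x0) i
        have h4 := abs_partial_le _ (hG.2.2.2.1 x0) i
        have h5 : |pderivP F i x0 * pderivQ F i x0| ≤ C * C := by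
          rw [abs_mul]; exact mul_le_mul h3.1 h3.2 (abs_nonneg _) hC
        have h6 : |pderivP G i x0 * pderivQ G i x0| ≤ C * C := by
          rw [abs_mul]; exact mul_le_mul h4.1 h4.2 (abs_nonneg _) hC
        have := (abs_le.1 h5).1
        have := (abs_le.1 h6).1
        nlinarith
      rw [Finset.sum_const, Finset.card_univ, Fintype.card_fin, nsmul_eq_mul] at this
      linarith
    have h2 := mul_le_mul_of_nonneg_left h1 (by positivity : 0 ≤ s ^ 2 / 4)
    linarith
  have hl0 : ∀ j ∈ Finset.range m, ‖lam m n j z0‖ ≤ 2 * s * C := by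
    intro j hj
    rw [Finset.mem_range] at hj
    rw [lam_apply]
    refine norm_phase_le (by positivity) (fun i => ?_) fun i => ?_
    · simp only [hz0, cX_mk _ _ hj, hxx]
      rw [abs_neg, abs_mul, abs_of_nonneg (by positivity : 0 ≤ s / m)]
      have h1 : |∑ l ∈ Finset.range m, lt01 j l * d l (0, Pi.single i 1)| ≤ m * (2 * C) := by
        refine (Finset.abs_sum_le_sum_abs _ _).trans ?_
        refine (Finset.sum_le_card_nsmul _ _ (2 * C) fun l _ => ?_).trans ?_
        · rw [abs_mul]
          have h2 : |lt01 j l| ≤ 1 := by rw [lt01]; split_ifs <;> simp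
          have h3 := (abs_partial_le _ (hdn l) i).2
          have := mul_le_mul h2 h3 (abs_nonneg _) zero_le_one
          linarith
        · rw [Finset.card_range, nsmul_eq_mul]
      calc _ ≤ s / m * (m * (2 * C)) := by gcongr
        _ = _ := by field_simp
    · simp only
      rw [abs_mul, abs_of_nonneg (by positivity : 0 ≤ 1 / (m : ℝ))]
      have h1 : |∑ k ∈ Finset.range j, cY z0 k i| ≤ m * (2 * s * C) := by
        refine (Finset.abs_sum_le_sum_abs _ _).trans ?_
        refine (Finset.sum_le_card_nsmul _ _ (2 * s * C) fun l hl => ?_).trans ?_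
        · rw [hz0, cY_mk _ _ ((Finset.mem_range.1 hl).trans hj), hyy]
          rw [abs_neg, abs_mul, abs_of_nonneg hs0]
          have h3 := (abs_partial_le _ (hdn l) i).1
          have := mul_le_mul_of_nonneg_left h3 hs0
          linarith
        · rw [Finset.card_range, nsmul_eq_mul]
          have : (j : ℝ) ≤ m := by exact_mod_cast hj.le
          gcongr
      calc _ ≤ 1 / (m : ℝ) * (m * (2 * s * C)) := by gcongr
        _ = _ := by field_simp
  refine ⟨fun v => z0 + diagL m n v, contDiff_const.add (diagL m n).contDiff,
    ⟨2, by norm_num, ‖sumL m n z0‖, fun v => ?_⟩, fun v => ?_⟩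
  · refine le_of_eq ?_
    congr 1
    have : sumL m n (diagL m n v) = (2 : ℝ) • v := by
      rw [sumL, add_apply, fst_diag, snd_diag, two_smul]
    rw [map_add, this, add_sub_cancel_right]
  · have hA := act_taylor (al_abs N) hF x0 (z0 + diagL m n v)
    have hB := act_taylor (be_abs N) hG x0 (z0 + diagL m n v)
    have hA0 : ∑ j ∈ Finset.range m, al N j * F x0 = 0 := by
      rw [hm, sum_al N fun _ => F x0]; simp
    have hB0 : ∑ j ∈ Finset.range m, be N j * G x0 = 0 := by
      rw [hm, sum_be N fun _ => G x0]; simp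
    have hsum : ∑ j ∈ Finset.range m, ‖lam m n j (z0 + diagL m n v)‖ ^ 2 ≤
        2 * (m * (2 * s * C) ^ 2) + 4 * ‖v‖ ^ 2 := by
      have h1 : ∑ j ∈ Finset.range m, ‖lam m n j (z0 + diagL m n v)‖ ^ 2 ≤
          ∑ j ∈ Finset.range m, (2 * (2 * s * C) ^ 2 + 2 * ‖lam m n j (diagL m n v)‖ ^ 2) := by
        refine Finset.sum_le_sum fun j hj => ?_
        rw [map_add]
        have h2 := norm_add_le (lam m n j z0) (lam m n j (diagL m n v))
        have h3 := hl0 j hj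
        have h4 : ‖lam m n j z0 + lam m n j (diagL m n v)‖ ^ 2 ≤
            (2 * s * C + ‖lam m n j (diagL m n v)‖) ^ 2 := by
          gcongr
          linarith
        nlinarith [sq_nonneg (2 * s * C - ‖lam m n j (diagL m n v)‖)]
      rw [Finset.sum_add_distrib, Finset.sum_const, Finset.card_range, nsmul_eq_mul,
        ← Finset.mul_sum] at h1
      have h2 := sum_lam_sq (diagL m n v)
      rw [norm_sq_EE, fst_diag, snd_diag] at h2
      linarith
    have hl := hlin (z0 + diagL m n v)
    have hdd : ∑ j ∈ Finset.range m, d j (lam m n j (z0 + diagL m n v)) =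
        ∑ j ∈ Finset.range m, al N j * fderiv ℝ F x0 (lam m n j (z0 + diagL m n v)) +
        ∑ j ∈ Finset.range m, be N j * fderiv ℝ G x0 (lam m n j (z0 + diagL m n v)) := by
      rw [← Finset.sum_add_distrib]
      exact Finset.sum_congr rfl fun j _ => hda j _
    rw [hdd, inner_add_right, inner_swap_self] at hl
    have hQd : QQ (diagL m n v) = ‖v‖ ^ 2 := by
      rw [QQ, fst_diag, snd_diag, real_inner_self_eq_norm_sq]
    beta_reduce
    rw [QQ_add, hQd]
    have hA' := mul_le_mul_of_nonneg_left hA hs0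
    have hB' := mul_le_mul_of_nonneg_left hB hs0
    have hS := mul_le_mul_of_nonneg_left hsum (by positivity : 0 ≤ 2 * s * C)
    rw [hA0] at hA'
    rw [hB0] at hB'
    have hv : 8 * s * C * ‖v‖ ^ 2 ≤ ‖v‖ ^ 2 := mul_le_of_le_one_left (by positivity) hs1
    rw [hcast] at hS
    nlinarith

lemma Nice.weaken {E : Type*} [NormedAddCommGroup E] [NormedSpace ℝ E] {φ : E → ℝ} {C D : ℝ}
    (h : Nice φ C) (hCD : C ≤ D) : Nice φ D := by
  obtain ⟨h1, h2, h3, h4, h5⟩ := h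
  exact ⟨h1, h2.trans hCD, fun z => (h3 z).trans hCD, fun z => (h4 z).trans hCD, fun z w =>
    (h5 z w).trans (mul_le_mul_of_nonneg_right hCD (norm_nonneg _))⟩

lemma exists_nice {n : ℕ} {F G : Phase n → ℝ} (hF : SmoothCpt F) (hG : SmoothCpt G) :
    ∃ C, Nice F C ∧ Nice G C := by
  obtain ⟨C, hC⟩ := hF.nice
  obtain ⟨D, hD⟩ := hG.nice
  exact ⟨max C D, hC.weaken (le_max_left _ _), hD.weaken (le_max_right _ _)⟩

lemma poisson_le_iSup {n : ℕ} {F G : Phase n → ℝ} {C : ℝ} (hF : Nice F C) (hG : Nice G C)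
    (x : Phase n) : poisson F G x ≤ ⨆ x, poisson F G x := by
  refine le_ciSup (f := fun x => poisson F G x) ⟨∑ i : Fin n, 2 * (C * C), ?_⟩ x
  rintro _ ⟨y, rfl⟩
  refine Finset.sum_le_sum fun i _ => ?_
  have hC := hF.2.1
  have h3 := abs_partial_le _ (hF.2.2.2.1 y) i
  have h4 := abs_partial_le _ (hG.2.2.2.1 y) i
  have h5 : |pderivQ F i y * pderivP G i y| ≤ C * C := by
    rw [abs_mul]; exact mul_le_mul h3.2 h4.1 (abs_nonneg _) hC
  have h6 : |pderivP F i y * pderivQ G i y| ≤ C * C := by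
    rw [abs_mul]; exact mul_le_mul h3.1 h4.2 (abs_nonneg _) hC
  have := (abs_le.1 h5).2
  have := (abs_le.1 h6).1
  linarith

lemma abs_le_of_unif {n : ℕ} {F F' : Phase n → ℝ} {C C' δ : ℝ} (hF : Nice F C) (hF' : Nice F' C')
    (h : unif (fun x => F' x - F x) < δ) (x : Phase n) : |F' x - F x| ≤ δ := by
  refine le_trans (le_ciSup (f := fun x => |F' x - F x|) ⟨C' + C, ?_⟩ x) h.le
  rintro _ ⟨y, rfl⟩
  exact (abs_sub _ _).trans (add_le_add (hF'.2.2.1 y) (hF.2.2.1 y))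

lemma act_close {m n : ℕ} {c : ℕ → ℝ} (hc : ∀ j, |c j| ≤ 1) {F F' : Phase n → ℝ} {δ : ℝ}
    (h : ∀ x, |F' x - F x| ≤ δ) (x0 : Phase n) (z : EE m n) :
    act c F x0 z - act c F' x0 z ≤ m * δ := by
  rw [act, act, ← Finset.sum_sub_distrib]
  refine (Finset.sum_le_card_nsmul _ _ δ fun j _ => ?_).trans ?_
  · rw [← mul_sub]
    refine (le_abs_self _).trans ?_
    rw [abs_mul, abs_sub_comm]
    have := mul_le_mul (hc j) (h (x0 + lam m n j z)) (abs_nonneg _) zero_le_one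
    linarith
  · rw [Finset.card_range, nsmul_eq_mul]

lemma main_ineq {n N : ℕ} (hN : 0 < N) {F G F' G' : Phase n → ℝ} {C C' M s δ e : ℝ}
    (hF : Nice F C) (hG : Nice G C) (hF' : Nice F' C') (hG' : Nice G' C')
    (hM : ∀ x, poisson F' G' x ≤ M) (x0 : Phase n) (hs0 : 0 < s) (hs1 : s ≤ 1)
    (hsC : 8 * s * C ≤ 1) (h1 : ∀ x, |F' x - F x| ≤ δ) (h2 : ∀ x, |G' x - G x| ≤ δ)
    (he : C' * (1 + C') * (2 * C' + 2) < N * e) :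
    N * (s ^ 2 / 4 * poisson F G x0 - 64 * s ^ 3 * C ^ 3) - s ^ 2 * n * C ^ 2 / 2 - 8 * N * s * δ ≤
      N * (s ^ 2 * M / 4 + 2 * s * e) := by
  have hN' : (0 : ℝ) < N := by exact_mod_cast hN
  have hcast : ((4 * N : ℕ) : ℝ) = 4 * N := by push_cast; ring
  refine upper_bound hN hF' hG' hM x0 hs0.le hs1 (κ := 1 / N) (by positivity) ?_
    ((lower_bound hN hF hG x0 hs0.le hsC).mono fun z => ?_)
  · rw [hcast]
    have : C' * (1 / N + 2 * (2 * C') / (4 * N)) * (2 * C' + 2) =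
        C' * (1 + C') * (2 * C' + 2) / N := by field_simp; ring
    rw [this, div_lt_iff₀ hN', mul_comm e]
    exact he
  · have h3 := act_close (al_abs N) h1 x0 z
    have h4 := act_close (be_abs N) h2 x0 z
    rw [hcast] at h3 h4
    have h5 := mul_le_mul_of_nonneg_left h3 hs0.le
    have h6 := mul_le_mul_of_nonneg_left h4 hs0.le
    linarith

end Helpers

/-- **Theorem (Entov–Polterovich).** Lower semicontinuity of `max {F,G}` in the uniform norm:
for every `ε > 0` there is `δ > 0` such that any `F', G' ∈ C_c^∞(ℝ^{2n})` that are
`δ`-close to `F, G` in the uniform norm satisfy `max {F',G'} > max {F,G} − ε`. -/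
theorem max_poisson_lower_semicontinuous (n : ℕ) (hn : 1 ≤ n) (F G : Phase n → ℝ)
    (hF : SmoothCpt F) (hG : SmoothCpt G) :
    ∀ ε > (0 : ℝ), ∃ δ > (0 : ℝ), ∀ F' G' : Phase n → ℝ,
      SmoothCpt F' → SmoothCpt G' →
      unif (fun x => F' x - F x) < δ → unif (fun x => G' x - G x) < δ →
      (⨆ x, poisson F' G' x) > (⨆ x, poisson F G x) - ε := by
  intro ε hε
  obtain ⟨C, hFC, hGC⟩ := exists_nice hF hG
  have hC : 0 ≤ C := hFC.2.1
  obtain ⟨x0, hx0⟩ := exists_lt_of_lt_ciSup (f := fun x => poisson F G x)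
    (show (⨆ x, poisson F G x) - ε / 2 < ⨆ x, poisson F G x by linarith)
  obtain ⟨s, hs0, hs1, hsC, hsε⟩ : ∃ s > (0 : ℝ), s ≤ 1 ∧ 8 * s * C ≤ 1 ∧
      256 * s * C ^ 3 ≤ ε / 16 := by
    refine ⟨min 1 (min (1 / (8 * (C + 1))) (ε / (4096 * (C ^ 3 + 1)))), by positivity,
      min_le_left _ _, ?_, ?_⟩
    · have h1 : min 1 (min (1 / (8 * (C + 1))) (ε / (4096 * (C ^ 3 + 1)))) ≤ 1 / (8 * (C + 1)) :=
        (min_le_right _ _).trans (min_le_left _ _)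
      rw [le_div_iff₀ (by positivity)] at h1
      have h2 : 0 < min 1 (min (1 / (8 * (C + 1))) (ε / (4096 * (C ^ 3 + 1)))) := by positivity
      linarith
    · have h1 : min 1 (min (1 / (8 * (C + 1))) (ε / (4096 * (C ^ 3 + 1)))) ≤
          ε / (4096 * (C ^ 3 + 1)) := (min_le_right _ _).trans (min_le_right _ _)
      rw [le_div_iff₀ (by positivity)] at h1
      have h2 : 0 < min 1 (min (1 / (8 * (C + 1))) (ε / (4096 * (C ^ 3 + 1)))) := by positivity
      linarith
  refine ⟨s * ε / 512, by positivity, fun F' G' hF' hG' hdF hdG => ?_⟩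
  obtain ⟨C', hFC', hGC'⟩ := exists_nice hF' hG'
  set e := s * ε / 128 with he
  have he0 : 0 < e := by positivity
  obtain ⟨N, hN⟩ := exists_nat_gt (max (C' * (1 + C') * (2 * C' + 2) / e) (32 * n * C ^ 2 / ε))
  have hN1 := (le_max_left _ _).trans_lt hN
  have hN2 := (le_max_right _ _).trans_lt hN
  have hC' : 0 ≤ C' := hFC'.2.1
  have hNpos : (0 : ℝ) < N := lt_of_le_of_lt (by positivity) hN1
  have hN0 : 0 < N := by exact_mod_cast hNpos
  rw [div_lt_iff₀ he0] at hN1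
  rw [div_lt_iff₀ hε] at hN2
  have key := main_ineq hN0 hFC hGC hFC' hGC' (poisson_le_iSup hFC' hGC') x0 hs0 hs1 hsC
    (abs_le_of_unif hFC hFC' hdF) (abs_le_of_unif hGC hGC' hdG) hN1
  set M := ⨆ x, poisson F' G' x
  set S := ⨆ x, poisson F G x
  set p := poisson F G x0
  have hx0' : S - ε / 2 < p := hx0
  have k1 : N * s ^ 2 * (256 * s * C ^ 3) ≤ N * s ^ 2 * (ε / 16) :=
    mul_le_mul_of_nonneg_left hsε (by positivity)
  have k2 : s ^ 2 * (32 * n * C ^ 2) ≤ s ^ 2 * (N * ε) :=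
    mul_le_mul_of_nonneg_left hN2.le (by positivity)
  have k3 : N * s ^ 2 * (p - ε / 4) ≤ N * s ^ 2 * M := by
    rw [he] at key
    linarith
  have k4 : p - ε / 4 ≤ M := le_of_mul_le_mul_left k3 (by positivity)
  linarith
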